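/- arXiv:2204.01936 — 8 statements merged into one kernel-verified Lean document; each statement's English description precedes it below -/
import Mathlib

section
/- There is an absolute constant c such that the following holds. If a bipartite graph G has 1-expansion up to K, then G has matching up to K with T-expiration and with load at most c·(log₂(K·T) + 1). -/
/-!
Bipartite graphs are modelled by a neighborhood function `Nbr : L → Finset R`
on finite types `L` (left nodes) and `R` (right nodes).

The dynamic matching game with parameters `K` and `ℓ` (the load):
Requester and Matcher maintain a set `M` of edges, initially empty, and alternate
turns with Requester first.  At round `n`, Requester removes a set of edges from `M`
(so that afterwards `#M ≤ K - 1`) and selects a left node; Matcher replies, according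
to her strategy, by adding one edge of the graph incident on the selected node,
and afterwards every right node must be incident on at most `ℓ` edges of `M`.
A strategy is winning if against every legal play of Requester all these
conditions always hold.
-/

namespace DM

/-- A Requester move: a set of edges to remove from the matching, and the requested left node. -/
abbrev ReqMove (α β : Type) := Finset (α × β) × α

/-- A Matcher strategy: maps each finite history of Requester moves to the set of
edges Matcher adds (a valid reply adds exactly one edge incident on the request). -/
abbrev Strategy (α β : Type) := List (ReqMove α β) → Finset (α × β)

/-- A Requester move in the ε-rich game: a set of left nodes whose requests are retracted
(all their matched edges are removed together), and the requested left node. -/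
abbrev RReqMove (α : Type) := Finset α × α

/-- A Matcher strategy in the ε-rich game: maps each finite history of Requester moves
to the set of edges Matcher adds. -/
abbrev RStrategy (α β : Type) := List (RReqMove α) → Finset (α × β)

variable {L R R₁ R₂ : Type} [DecidableEq L] [DecidableEq R] [DecidableEq R₁] [DecidableEq R₂]

/-- The set of neighbors of a set `S` of left nodes. -/
def NbrSet (Nbr : L → Finset R) (S : Finset L) : Finset R := S.biUnion Nbr

/-- The graph has `e`-expansion up to `K`: every left set `S` with `#S ≤ K`
has at least `e · #S` neighbors. -/
def Expansion (Nbr : L → Finset R) (e : ℚ) (K : ℕ) : Prop :=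
  ∀ S : Finset L, S.card ≤ K → e * (S.card : ℚ) ≤ ((NbrSet Nbr S).card : ℚ)

/-- The `ℓ`-clone of a graph: `ℓ` copies of the right set, with `x` adjacent to `(y, i)`
iff `x` is adjacent to `y` in the original graph. -/
def clone (ℓ : ℕ) (Nbr : L → Finset R) : L → Finset (R × Fin ℓ) :=
  fun x => (Nbr x) ×ˢ (Finset.univ : Finset (Fin ℓ))

/-- The product of two graphs with the same left set: `x` is adjacent to `(y₁, y₂)` iff
`x` is adjacent to `y₁` in the first graph and to `y₂` in the second graph. -/
def prodGraph (Nbr₁ : L → Finset R₁) (Nbr₂ : L → Finset R₂) : L → Finset (R₁ × R₂) :=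
  fun x => (Nbr₁ x) ×ˢ (Nbr₂ x)

/-- The private neighbors of a left set `S`: right nodes with exactly one neighbor in `S`. -/
def privNbrs [Fintype R] (Nbr : L → Finset R) (S : Finset L) : Finset R :=
  Finset.univ.filter fun y => (S.filter fun x => y ∈ Nbr x).card = 1

/-- The history of Requester moves after round `n` (i.e. the moves of rounds `0, …, n`). -/
def histUpTo (req : ℕ → ReqMove L R) (n : ℕ) : List (ReqMove L R) :=
  List.ofFn fun i : Fin (n + 1) => req i.1

/-- The matching `M` after round `n` of play: at round `n`, Requester removes the edges
`(req n).1` and requests `(req n).2`, then Matcher adds the edge(s) given by her strategy. -/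
def matchingAfter (σ : Strategy L R) (req : ℕ → ReqMove L R) : ℕ → Finset (L × R)
  | 0 => ∅
  | n + 1 => σ (histUpTo req n) ∪ (matchingAfter σ req n \ (req n).1)

/-- Requester's move at round `n` is legal: after his removal, `#M ≤ K - 1`. -/
def RemLegal (σ : Strategy L R) (K : ℕ) (req : ℕ → ReqMove L R) (n : ℕ) : Prop :=
  (matchingAfter σ req n \ (req n).1).card < K

/-- Matcher's reply at round `n` is valid for load `ℓ`: she adds exactly one edge of the
graph, incident on the requested node, and afterwards every right node is incident on
at most `ℓ` edges of `M`. -/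
def ValidReply (Nbr : L → Finset R) (ℓ : ℕ) (σ : Strategy L R)
    (req : ℕ → ReqMove L R) (n : ℕ) : Prop :=
  (∃ y ∈ Nbr (req n).2, σ (histUpTo req n) = {((req n).2, y)}) ∧
  ∀ y : R, ((matchingAfter σ req (n + 1)).filter fun p => p.2 = y).card ≤ ℓ

/-- The graph has dynamic matching up to `K` with load `ℓ`: Matcher has a strategy that
replies validly to every legal play of Requester. -/
def DynamicMatching (Nbr : L → Finset R) (K ℓ : ℕ) : Prop :=
  ∃ σ : Strategy L R, ∀ req : ℕ → ReqMove L R, ∀ n : ℕ,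
    (∀ i ≤ n, RemLegal σ K req i) → ValidReply Nbr ℓ σ req n

/-- Incremental matching up to `K` with load `ℓ`: Requester never removes edges,
and the game lasts at most `K` rounds. -/
def IncrementalMatching (Nbr : L → Finset R) (K ℓ : ℕ) : Prop :=
  ∃ σ : Strategy L R, ∀ req : ℕ → ReqMove L R, (∀ i, (req i).1 = ∅) →
    ∀ n < K, ValidReply Nbr ℓ σ req n

/-- Matching with `T` rounds up to `K` with load `ℓ`: the dynamic matching game is
terminated after `T` rounds. -/
def RoundMatching (Nbr : L → Finset R) (T K ℓ : ℕ) : Prop :=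
  ∃ σ : Strategy L R, ∀ req : ℕ → ReqMove L R, ∀ n < T,
    (∀ i ≤ n, RemLegal σ K req i) → ValidReply Nbr ℓ σ req n

/-- The edge Matcher added at round `i` is removed by Requester during one of the
rounds `i + 1, …, i + T`. -/
def ExpiredAt (σ : Strategy L R) (T : ℕ) (req : ℕ → ReqMove L R) (i : ℕ) : Prop :=
  ∃ j, i < j ∧ j ≤ i + T ∧ ∀ e ∈ σ (histUpTo req i), e ∈ (req j).1

/-- Matching up to `K` with `T`-expiration and load `ℓ`: the dynamic matching game in
which Requester must remove the edge added at round `i` during one of the rounds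
`i + 1, …, i + T`. -/
def ExpiringMatching (Nbr : L → Finset R) (T K ℓ : ℕ) : Prop :=
  ∃ σ : Strategy L R, ∀ req : ℕ → ReqMove L R, ∀ n : ℕ,
    (∀ i ≤ n, RemLegal σ K req i) → (∀ i, i + T ≤ n → ExpiredAt σ T req i) →
    ValidReply Nbr ℓ σ req n

/-! ### The ε-rich matching game

In the ε-rich game on a graph with left degree `D`, when Requester requests a left node
`x`, Matcher adds to `M` in one round a set of at least `(1 - ε) · D` edges incident on
`x`; when Requester retracts a request, all its edges are removed together. -/

/-- The history of rich-game Requester moves after round `n`. -/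
def rhistUpTo (req : ℕ → RReqMove L) (n : ℕ) : List (RReqMove L) :=
  List.ofFn fun i : Fin (n + 1) => req i.1

/-- The matching `M` after round `n` of the rich game: at round `n`, Requester retracts
the requests of the left nodes in `(req n).1` (removing all their edges) and requests
`(req n).2`, then Matcher adds the set of edges given by her strategy. -/
def rmatchingAfter (σ : RStrategy L R) (req : ℕ → RReqMove L) : ℕ → Finset (L × R)
  | 0 => ∅
  | n + 1 => σ (rhistUpTo req n) ∪
      ((rmatchingAfter σ req n).filter fun p => p.1 ∉ (req n).1)

/-- Requester's rich-game move at round `n` is legal: after the retraction, at most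
`K - 1` requests remain matched. -/
def RRemLegal (σ : RStrategy L R) (K : ℕ) (req : ℕ → RReqMove L) (n : ℕ) : Prop :=
  ((((rmatchingAfter σ req n).filter fun p => p.1 ∉ (req n).1)).image Prod.fst).card < K

/-- Matcher's rich reply at round `n` is valid for richness `ε` (relative to left degree
`D`) and load `ℓ`: she adds at least `(1 - ε) · D` edges of the graph, all incident on
the requested node, and afterwards every right node is incident on at most `ℓ` edges. -/
def RValidReply (Nbr : L → Finset R) (D : ℕ) (ε : ℚ) (ℓ : ℕ) (σ : RStrategy L R)
    (req : ℕ → RReqMove L) (n : ℕ) : Prop :=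
  (∀ e ∈ σ (rhistUpTo req n), e.1 = (req n).2 ∧ e.2 ∈ Nbr e.1) ∧
  (1 - ε) * (D : ℚ) ≤ ((σ (rhistUpTo req n)).card : ℚ) ∧
  ∀ y : R, ((rmatchingAfter σ req (n + 1)).filter fun p => p.2 = y).card ≤ ℓ

/-- ε-rich matching up to `K` with load `ℓ` (richness relative to left degree `D`). -/
def RichMatching (Nbr : L → Finset R) (D : ℕ) (ε : ℚ) (K ℓ : ℕ) : Prop :=
  ∃ σ : RStrategy L R, ∀ req : ℕ → RReqMove L, ∀ n : ℕ,
    (∀ i ≤ n, RRemLegal σ K req i) → RValidReply Nbr D ε ℓ σ req n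

/-- Incremental ε-rich matching up to `K` with load `ℓ`: Requester never retracts,
and the game lasts at most `K` rounds. -/
def RichIncrementalMatching (Nbr : L → Finset R) (D : ℕ) (ε : ℚ) (K ℓ : ℕ) : Prop :=
  ∃ σ : RStrategy L R, ∀ req : ℕ → RReqMove L, (∀ i, (req i).1 = ∅) →
    ∀ n < K, RValidReply Nbr D ε ℓ σ req n

/-- ε-rich matching up to `K` with `T`-expiration and load `ℓ`: Requester must retract
the request made at round `i` during one of the rounds `i + 1, …, i + T`. -/
def RichExpiringMatching (Nbr : L → Finset R) (D : ℕ) (ε : ℚ) (T K ℓ : ℕ) : Prop :=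
  ∃ σ : RStrategy L R, ∀ req : ℕ → RReqMove L, ∀ n : ℕ,
    (∀ i ≤ n, RRemLegal σ K req i) →
    (∀ i, i + T ≤ n → ∃ j, i < j ∧ j ≤ i + T ∧ (req i).2 ∈ (req j).1) →
    RValidReply Nbr D ε ℓ σ req n

end DM


/-!
Matcher works with layers `j = 0, 1, 2, …`, each of which owns two copies of the 2-clone of the
graph.  Time is divided, for layer `j`, into epochs of `K * 2 ^ min j J` rounds.  At the start of
an epoch the layer selects the copy with fewer occupied cells, and declares these cells blocked
for the whole epoch; afterwards it serves left nodes greedily, reserving for the rest of the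
epoch the cell of a left node that it has served.  A request goes to the first layer able to
serve it.  By expansion, at most half of the left nodes that reach a layer during an epoch are
passed to the next layer, whose epochs are twice as long.
-/

namespace DM

noncomputable section

/-- The memory of a layer during an epoch: the cells blocked at the start of the epoch, the cells
reserved for the left nodes served so far, and the left nodes that have reached the layer. -/
structure Layer (L R : Type) where
  blocked : Finset (R × Fin 2)
  served : L → Option (R × Fin 2)
  seen : Finset L

namespace Layer

variable {L R : Type}

/-- A cell that can be newly reserved for `x`. -/
def Free (Nbr : L → Finset R) (ly : Layer L R) (x : L) (c : R × Fin 2) : Prop :=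
  c.1 ∈ Nbr x ∧ c ∉ ly.blocked ∧ ∀ x', ly.served x' ≠ some c

open Classical in
/-- The cell given to `x`: the one reserved for it, or else some free one, if any. -/
def cell (Nbr : L → Finset R) (ly : Layer L R) (x : L) : Option (R × Fin 2) :=
  if (ly.served x).isSome then ly.served x
  else if h : ∃ c, ly.Free Nbr x c then some h.choose else none

/-- The left nodes that have reached the layer and were passed on. -/
def unserved (ly : Layer L R) : Finset L := ly.seen.filter fun x => ly.served x = none

/-- The invariant of a layer. -/
structure Ok (Nbr : L → Finset R) (ly : Layer L R) : Prop where
  adj : ∀ x c, ly.served x = some c → c.1 ∈ Nbr x ∧ c ∉ ly.blocked ∧ x ∈ ly.seen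
  inj : ∀ x x' c, ly.served x = some c → ly.served x' = some c → x = x'
  full : ∀ x ∈ ly.seen, ly.served x = none → ∀ c, ¬ ly.Free Nbr x c

variable {Nbr : L → Finset R} {ly : Layer L R}

lemma cell_of_served {x : L} {c : R × Fin 2} (h : ly.served x = some c) :
    ly.cell Nbr x = some c := by
  simp [cell, h]

lemma cell_eq_none {x : L} :
    ly.cell Nbr x = none ↔ ly.served x = none ∧ ∀ c, ¬ ly.Free Nbr x c := by
  unfold cell
  split_ifs with h1 h2
  · simp only [Option.isSome_iff_ne_none] at h1
    simp [h1]
  · simp only [false_iff, not_and, not_forall, not_not]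
    exact fun _ => h2
  · simp only [Option.isSome_iff_ne_none, not_not] at h1
    simpa [h1] using h2

lemma cell_eq_some {x : L} {c : R × Fin 2} (h : ly.cell Nbr x = some c) :
    ly.served x = some c ∨ ly.served x = none ∧ ly.Free Nbr x c := by
  unfold cell at h
  split_ifs at h with h1 h2
  · exact Or.inl h
  · simp only [Option.isSome_iff_ne_none, not_not] at h1
    exact Or.inr ⟨h1, by simpa [← Option.some.inj h] using h2.choose_spec⟩

/-- By expansion, at most a third of the nodes reaching a layer are passed on, up to the
number of cells that were blocked at the start of the epoch. -/
lemma Ok.card_unserved [DecidableEq R] (h : ly.Ok Nbr) {K : ℕ} (hG : Expansion Nbr 1 K)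
    (hK : ly.seen.card ≤ K) : 3 * ly.unserved.card ≤ ly.blocked.card + ly.seen.card := by
  classical
  have hexp : ly.unserved.card ≤ (NbrSet Nbr ly.unserved).card := by
    have := hG ly.unserved ((Finset.card_le_card (Finset.filter_subset _ _)).trans hK)
    rw [one_mul] at this
    exact_mod_cast this
  set D := ly.seen.filter fun x => ly.served x ≠ none with hD
  have hsplit : ly.unserved.card + D.card = ly.seen.card :=
    Finset.card_filter_add_card_filter_not (s := ly.seen) (fun x => ly.served x = none)
  have hsub : NbrSet Nbr ly.unserved ×ˢ (Finset.univ : Finset (Fin 2)) ⊆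
      ly.blocked ∪ D.biUnion fun x => (ly.served x).toFinset := by
    intro c hc
    simp only [Finset.mem_product, NbrSet, Finset.mem_biUnion, unserved, Finset.mem_filter] at hc
    obtain ⟨⟨x, ⟨hx, hn⟩, hy⟩, -⟩ := hc
    have hnf := h.full x hx hn c
    by_contra hcon
    simp only [Finset.mem_union, Finset.mem_biUnion, not_or, not_exists, not_and] at hcon
    refine hnf ⟨hy, hcon.1, fun x' hx' => hcon.2 x' ?_ ?_⟩
    · simp [hD, hx', (h.adj _ _ hx').2.2]
    · simp [hx']
  have h1 := Finset.card_le_card hsub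
  have h2 : (D.biUnion fun x => (ly.served x).toFinset).card ≤ D.card * 1 :=
    Finset.card_biUnion_le_card_mul _ _ _ fun x _ => by
      cases ly.served x <;> simp
  have h3 := Finset.card_union_le ly.blocked (D.biUnion fun x => (ly.served x).toFinset)
  rw [Finset.card_product, Finset.card_univ, Fintype.card_fin] at h1
  omega

variable [DecidableEq L]

/-- The layer after a request `x` has reached it. -/
def ask (Nbr : L → Finset R) (ly : Layer L R) (x : L) : Layer L R where
  blocked := ly.blocked
  served := Function.update ly.served x (ly.cell Nbr x)
  seen := insert x ly.seen

lemma ask_served_of_served {x x' : L} {c : R × Fin 2} (h : ly.served x' = some c) :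
    (ly.ask Nbr x).served x' = some c := by
  by_cases hx : x' = x
  · subst hx; simp [ask, cell_of_served h]
  · simpa [ask, hx] using h

lemma Ok.ask (h : ly.Ok Nbr) (x : L) : (ly.ask Nbr x).Ok Nbr where
  adj x' c hc := by
    by_cases hx : x' = x
    · subst hx
      simp only [Layer.ask, Function.update_self] at hc
      rcases cell_eq_some hc with h1 | ⟨-, h1⟩
      · exact ⟨(h.adj _ _ h1).1, (h.adj _ _ h1).2.1, by simp [Layer.ask]⟩
      · exact ⟨h1.1, h1.2.1, by simp [Layer.ask]⟩
    · simp only [Layer.ask, Function.update_of_ne hx] at hc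
      exact ⟨(h.adj _ _ hc).1, (h.adj _ _ hc).2.1,
        Finset.mem_insert_of_mem (h.adj _ _ hc).2.2⟩
  inj := by
    have key : ∀ x' c, x' ≠ x → ly.cell Nbr x = some c → ly.served x' ≠ some c := by
      intro x' c hx hc hs
      rcases cell_eq_some hc with h1 | ⟨-, h1⟩
      · exact hx (h.inj _ _ _ hs h1)
      · exact h1.2.2 _ hs
    intro x₁ x₂ c h₁ h₂
    by_cases e₁ : x₁ = x <;> by_cases e₂ : x₂ = x
    · rw [e₁, e₂]
    · subst e₁
      simp only [Layer.ask, Function.update_self, Function.update_of_ne e₂] at h₁ h₂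
      exact absurd h₂ (key _ _ e₂ h₁)
    · subst e₂
      simp only [Layer.ask, Function.update_self, Function.update_of_ne e₁] at h₁ h₂
      exact absurd h₁ (key _ _ e₁ h₂)
    · simp only [Layer.ask, Function.update_of_ne e₁, Function.update_of_ne e₂] at h₁ h₂
      exact h.inj _ _ _ h₁ h₂
  full x' hx' hn c hc := by
    have hc' : ly.Free Nbr x' c :=
      ⟨hc.1, hc.2.1, fun x'' h'' => hc.2.2 x'' (ask_served_of_served h'')⟩
    by_cases hx : x' = x
    · subst hx
      simp only [Layer.ask, Function.update_self] at hn
      exact (cell_eq_none.1 hn).2 c hc'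
    · simp only [Layer.ask, Function.update_of_ne hx, Finset.mem_insert, hx, false_or] at hn hx'
      exact h.full x' hx' hn c hc'

lemma Ok.unserved_subset_ask (h : ly.Ok Nbr) (x : L) :
    ly.unserved ⊆ (ly.ask Nbr x).unserved := by
  intro x' hx'
  simp only [unserved, Finset.mem_filter] at hx' ⊢
  refine ⟨Finset.mem_insert_of_mem hx'.1, ?_⟩
  by_cases hx : x' = x
  · subst hx
    simpa [Layer.ask] using cell_eq_none.2 ⟨hx'.2, h.full _ hx'.1 hx'.2⟩
  · simpa [Layer.ask, hx] using hx'.2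

lemma mem_unserved_ask {x : L} (h : ly.cell Nbr x = none) : x ∈ (ly.ask Nbr x).unserved := by
  simp [unserved, Layer.ask, h]

end Layer

/-- The length of the epochs of layer `j`. -/
def epochLen (K J j : ℕ) : ℕ := K * 2 ^ min j J

/-- Twice the number of left nodes that layer `j` may have passed on during earlier epochs
contained in the current epoch of layer `j + 1`, at round `e`. -/
def carryBound (K J e j : ℕ) : ℕ := if j < J then K * ((e / epochLen K J j) % 2) else 0

/-- The joint invariant of the layers at round `e`, before (`d = 0`) or after (`d = 1`) the
request is processed. -/
structure LayersOk {L R : Type} [DecidableEq L] (Nbr : L → Finset R) (K J e d : ℕ)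
    (layer : ℕ → Layer L R) : Prop where
  ok : ∀ j, (layer j).Ok Nbr
  blocked_card : ∀ j, 2 * (layer j).blocked.card ≤ K
  blocked_late : ∀ j, J ≤ j → (layer j).blocked = ∅
  carry : ∀ j, 2 * ((layer (j + 1)).seen \ (layer j).unserved).card ≤ carryBound K J e j
  seen_zero : (layer 0).seen.card ≤ e % K + d

section Layers

variable {L R : Type} [DecidableEq L] {Nbr : L → Finset R} {K J e d : ℕ}
  {layer : ℕ → Layer L R}

lemma epochLen_pos (hK : 0 < K) (j : ℕ) : 0 < epochLen K J j := by
  unfold epochLen; positivity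

lemma carryBound_le (j : ℕ) : carryBound K J e j ≤ K := by
  unfold carryBound
  split_ifs
  · calc K * _ ≤ K * 1 := Nat.mul_le_mul_left _ (by omega)
      _ = K := mul_one K
  · omega

open Classical in
/-- The layers after a request `x`: it reaches layer `j` if no earlier layer serves it. -/
def askLayers (Nbr : L → Finset R) (layer : ℕ → Layer L R) (x : L) (j : ℕ) : Layer L R :=
  if ∀ i < j, (layer i).cell Nbr x = none then (layer j).ask Nbr x else layer j

lemma LayersOk.ask (h : LayersOk Nbr K J e 0 layer) (x : L) :
    LayersOk Nbr K J e 1 (askLayers Nbr layer x) where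
  ok j := by
    unfold askLayers
    split_ifs
    · exact (h.ok j).ask x
    · exact h.ok j
  blocked_card j := by
    unfold askLayers
    split_ifs <;> exact h.blocked_card j
  blocked_late j hj := by
    unfold askLayers
    split_ifs <;> exact h.blocked_late j hj
  carry j := by
    refine le_trans ?_ (h.carry j)
    refine Nat.mul_le_mul_left _ (Finset.card_le_card ?_)
    have hmono : (layer j).unserved ⊆ (askLayers Nbr layer x j).unserved := by
      unfold askLayers
      split_ifs
      · exact (h.ok j).unserved_subset_ask x
      · exact subset_rfl
    by_cases hp : ∀ i < j + 1, (layer i).cell Nbr x = none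
    · have hx : x ∈ (askLayers Nbr layer x j).unserved := by
        rw [askLayers, if_pos fun i hi => hp i (by omega)]
        exact Layer.mem_unserved_ask (hp j (by omega))
      intro z hz
      rw [askLayers, if_pos hp] at hz
      simp only [Layer.ask, Finset.mem_sdiff, Finset.mem_insert] at hz ⊢
      rcases hz with ⟨rfl | hz, hz'⟩
      · exact absurd hx hz'
      · exact ⟨hz, fun hu => hz' (hmono hu)⟩
    · rw [askLayers, if_neg hp]
      exact Finset.sdiff_subset_sdiff subset_rfl hmono
  seen_zero := by
    simp only [askLayers, not_lt_zero, false_imp_iff, implies_true, if_true, Layer.ask]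
    have := Finset.card_insert_le x (layer 0).seen
    have := h.seen_zero
    omega

variable [DecidableEq R]

lemma LayersOk.card_seen (h : LayersOk Nbr K J e d layer) (hG : Expansion Nbr 1 K) (hK : 0 < K)
    (hd : d ≤ 1) (j : ℕ) : (layer j).seen.card ≤ K / 2 ^ (j - J) := by
  induction j with
  | zero =>
    have := h.seen_zero
    have := Nat.mod_lt e hK
    simp only [Nat.zero_sub, pow_zero, Nat.div_one]
    omega
  | succ j ih =>
    have hle : (layer j).seen.card ≤ K := ih.trans (Nat.div_le_self _ _)
    have h3 := (h.ok j).card_unserved hG hle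
    have hc := h.carry j
    have hsum : (layer (j + 1)).seen.card ≤
        ((layer (j + 1)).seen \ (layer j).unserved).card + (layer j).unserved.card := by
      have := Finset.card_le_card_sdiff_add_card (s := (layer (j + 1)).seen)
        (t := (layer j).unserved)
      omega
    by_cases hj : j < J
    · have := h.blocked_card j
      have := carryBound_le (K := K) (J := J) (e := e) j
      have hz : j + 1 - J = 0 := by omega
      rw [hz, pow_zero, Nat.div_one]
      omega
    · have hi := h.blocked_late j (by omega)
      simp only [hi, Finset.card_empty, zero_add] at h3
      have hc0 : carryBound K J e j = 0 := by simp [carryBound, hj]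
      have hz : j + 1 - J = (j - J) + 1 := by omega
      rw [hz, pow_succ, ← Nat.div_div_eq_div_mul]
      omega

lemma LayersOk.card_unserved (h : LayersOk Nbr K J e d layer) (hG : Expansion Nbr 1 K)
    (hK : 0 < K) (hd : d ≤ 1) (j : ℕ) : 2 * (layer j).unserved.card ≤ K := by
  have hle := (h.card_seen hG hK hd j).trans (Nat.div_le_self _ _)
  have := (h.ok j).card_unserved hG hle
  have := h.blocked_card j
  omega

lemma LayersOk.lt_of_mem_seen (h : LayersOk Nbr K J e d layer) (hG : Expansion Nbr 1 K)
    (hK : 0 < K) (hd : d ≤ 1) {j : ℕ} {x : L} (hx : x ∈ (layer j).seen) :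
    j < J + Nat.log 2 K + 1 := by
  have h1 := h.card_seen hG hK hd j
  have h2 : 0 < (layer j).seen.card := Finset.card_pos.2 ⟨x, hx⟩
  have h3 : 2 ^ (j - J) ≤ K := by
    by_contra hcon
    rw [Nat.div_eq_of_lt (by omega)] at h1
    omega
  have := Nat.le_log_of_pow_le (by norm_num) h3
  omega

open Classical in
/-- The layers at the beginning of round `n`, where `start j` is the set of cells that
layer `j` blocks if a new epoch begins. -/
def resetLayers (K J n : ℕ) (start : ℕ → Finset (R × Fin 2)) (layer : ℕ → Layer L R) (j : ℕ) :
    Layer L R :=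
  if epochLen K J j ∣ n then ⟨start j, fun _ => none, ∅⟩ else layer j

lemma LayersOk.reset {n : ℕ} (h : LayersOk Nbr K J (n - 1) 1 layer) (hG : Expansion Nbr 1 K)
    (hK : 0 < K) {start : ℕ → Finset (R × Fin 2)} (hs : ∀ j, 2 * (start j).card ≤ K)
    (hl : ∀ j, J ≤ j → epochLen K J j ∣ n → start j = ∅) :
    LayersOk Nbr K J n 0 (resetLayers K J n start layer) where
  ok j := by
    unfold resetLayers
    split_ifs
    · exact ⟨by simp, by simp, by simp⟩
    · exact h.ok j
  blocked_card j := by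
    unfold resetLayers
    split_ifs
    · exact hs j
    · exact h.blocked_card j
  blocked_late j hj := by
    unfold resetLayers
    split_ifs with hd
    · exact hl j hj hd
    · exact h.blocked_late j hj
  carry j := by
    by_cases h1 : epochLen K J (j + 1) ∣ n
    · simp [resetLayers, h1]
    have hn : n ≠ 0 := by rintro rfl; exact h1 (dvd_zero _)
    obtain ⟨m, rfl⟩ := Nat.exists_eq_succ_of_ne_zero hn
    have hc := h.carry j
    simp only [Nat.succ_eq_add_one, Nat.add_sub_cancel] at hc h1 ⊢
    have hdiv := Nat.succ_div (a := m) (b := epochLen K J j)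
    by_cases h0 : epochLen K J j ∣ m + 1
    · have hj : j < J := by
        by_contra hj
        refine h1 ?_
        have : min (j + 1) J = min j J := by omega
        rwa [epochLen, this]
      rw [if_pos h0] at hdiv
      obtain ⟨q, hq⟩ := h0
      have hlen : epochLen K J (j + 1) = epochLen K J j * 2 := by
        have e1 : min (j + 1) J = j + 1 := by omega
        have e2 : min j J = j := by omega
        rw [epochLen, epochLen, e1, e2, pow_succ, mul_assoc]
      have hqdiv : (m + 1) / epochLen K J j = q := by
        rw [hq]; exact Nat.mul_div_cancel_left _ (epochLen_pos hK j)
      have hodd : q % 2 = 1 := by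
        by_contra hq2
        refine h1 ⟨q / 2, ?_⟩
        rw [hq, hlen, mul_assoc, Nat.mul_div_cancel' (by omega)]
      have hcar : carryBound K J m j = 0 := by
        have : m / epochLen K J j % 2 = 0 := by omega
        simp [carryBound, this]
      have hcar' : carryBound K J (m + 1) j = K := by
        simp [carryBound, hj, hqdiv, hodd]
      rw [hcar] at hc
      have hsub : (layer (j + 1)).seen ⊆ (layer j).unserved := by
        rw [← Finset.sdiff_eq_empty_iff_subset, ← Finset.card_eq_zero]
        omega
      have hu := h.card_unserved hG hK le_rfl j
      rw [hcar', resetLayers, if_neg h1]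
      refine le_trans ?_ hu
      exact Nat.mul_le_mul_left _ (Finset.card_le_card (Finset.sdiff_subset.trans hsub))
    · rw [if_neg h0, add_zero] at hdiv
      rw [resetLayers, resetLayers, if_neg h1, if_neg h0, carryBound, hdiv]
      exact hc
  seen_zero := by
    have hlen : epochLen K J 0 = K := by simp [epochLen]
    unfold resetLayers
    split_ifs with hd
    · simp
    · rw [hlen] at hd
      have hn : n ≠ 0 := by rintro rfl; exact hd (dvd_zero _)
      obtain ⟨m, rfl⟩ := Nat.exists_eq_succ_of_ne_zero hn
      have := h.seen_zero
      simp only [Nat.succ_eq_add_one, Nat.add_sub_cancel] at this hd ⊢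
      have hdiv := Nat.succ_div (a := m) (b := K)
      rw [if_neg hd, add_zero] at hdiv
      have e1 := Nat.mod_add_div m K
      have e2 := Nat.mod_add_div (m + 1) K
      rw [hdiv] at e2
      omega

end Layers

/-- A slot: a layer, one of its two copies, and a cell in it. -/
abbrev Slot (R : Type) := ℕ × Bool × R × Fin 2

section RemoveEdges

variable {L R : Type} [DecidableEq L] [DecidableEq R]

/-- The slots in use after Requester has removed the edges in `rem`. -/
def removeEdges (cur : L → Option (Slot R)) (rem : Finset (L × R)) (x : L) : Option (Slot R) :=
  (cur x).filter fun q => decide ((x, q.2.2.1) ∉ rem)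

lemma removeEdges_eq_some {cur : L → Option (Slot R)} {rem : Finset (L × R)} {x : L}
    {q : Slot R} :
    removeEdges cur rem x = some q ↔ cur x = some q ∧ (x, q.2.2.1) ∉ rem := by
  simp [removeEdges, Option.filter_eq_some_iff]

end RemoveEdges

section Slots

variable {L R : Type} [Fintype L] [Fintype R] [DecidableEq R]

open Classical in
/-- The set of matched edges. -/
def edges (cur : L → Option (Slot R)) : Finset (L × R) :=
  Finset.univ.filter fun p => ∃ q, cur p.1 = some q ∧ q.2.2.1 = p.2

lemma mem_edges {cur : L → Option (Slot R)} {p : L × R} :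
    p ∈ edges cur ↔ ∃ q, cur p.1 = some q ∧ q.2.2.1 = p.2 := by
  simp [edges]

open Classical in
/-- The occupied cells of copy `b` of layer `j`. -/
def occupied (cur : L → Option (Slot R)) (j : ℕ) (b : Bool) : Finset (R × Fin 2) :=
  Finset.univ.filter fun c => ∃ x, cur x = some (j, b, c)

lemma mem_occupied {cur : L → Option (Slot R)} {j : ℕ} {b : Bool} {c : R × Fin 2} :
    c ∈ occupied cur j b ↔ ∃ x, cur x = some (j, b, c) := by
  simp [occupied]

lemma card_occupied_add (cur : L → Option (Slot R)) (j : ℕ) (b : Bool) :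
    (occupied cur j b).card + (occupied cur j !b).card ≤ (edges cur).card := by
  classical
  let X (b : Bool) : Finset L := Finset.univ.filter fun x => ∃ c, cur x = some (j, b, c)
  have hX : ∀ b, (occupied cur j b).card ≤ (X b).card := by
    intro b
    have hsub : occupied cur j b ⊆
        (X b).biUnion fun x => ((cur x).map fun q => q.2.2).toFinset := by
      intro c hc
      obtain ⟨x, hx⟩ := mem_occupied.1 hc
      refine Finset.mem_biUnion.2 ⟨x, Finset.mem_filter.2 ⟨Finset.mem_univ _, c, hx⟩, ?_⟩
      rw [hx, Option.map_some, Option.toFinset_some, Finset.mem_singleton]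
    have h1 := Finset.card_le_card hsub
    have h2 : ((X b).biUnion fun x => ((cur x).map fun q => q.2.2).toFinset).card ≤
        (X b).card * 1 :=
      Finset.card_biUnion_le_card_mul _ _ _ fun x _ => by cases cur x <;> simp
    omega
  have hdisj : Disjoint (X b) (X !b) := by
    rw [Finset.disjoint_left]
    intro x hx hx'
    simp only [X, Finset.mem_filter, Finset.mem_univ, true_and] at hx hx'
    obtain ⟨c, hc⟩ := hx
    obtain ⟨c', hc'⟩ := hx'
    rw [hc] at hc'
    simp at hc'
  have hsub : X b ∪ X (!b) ⊆ (edges cur).image Prod.fst := by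
    have hb : ∀ b, X b ⊆ (edges cur).image Prod.fst := by
      intro b x hx
      simp only [X, Finset.mem_filter, Finset.mem_univ, true_and] at hx
      obtain ⟨c, hc⟩ := hx
      exact Finset.mem_image.2 ⟨(x, c.1), mem_edges.2 ⟨_, hc, rfl⟩, rfl⟩
    exact Finset.union_subset (hb _) (hb _)
  have h1 := Finset.card_le_card hsub
  rw [Finset.card_union_of_disjoint hdisj] at h1
  have h2 := Finset.card_image_le (s := edges cur) (f := Prod.fst)
  have h3 := hX b
  have h4 := hX !b
  omega

/-- The copy of layer `j` with fewer occupied cells. -/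
def lighter (cur : L → Option (Slot R)) (j : ℕ) : Bool :=
  decide ((occupied cur j true).card ≤ (occupied cur j false).card)

lemma card_occupied_lighter (cur : L → Option (Slot R)) (j : ℕ) (b : Bool) :
    (occupied cur j (lighter cur j)).card ≤ (occupied cur j b).card := by
  unfold lighter
  by_cases h : (occupied cur j true).card ≤ (occupied cur j false).card
  · rw [decide_eq_true h]; cases b <;> omega
  · rw [decide_eq_false h]; cases b <;> omega

lemma two_mul_card_occupied_lighter (cur : L → Option (Slot R)) (j : ℕ) :
    2 * (occupied cur j (lighter cur j)).card ≤ (edges cur).card := by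
  have h1 := card_occupied_add cur j (lighter cur j)
  have h2 := card_occupied_lighter cur j (!(lighter cur j))
  omega

/-- If the slots of distinct left nodes are distinct and lie in the first `N` layers, then
every right node has load at most `4 * N`. -/
lemma card_edges_filter_le {cur : L → Option (Slot R)} {N : ℕ}
    (hinj : ∀ x x' q, cur x = some q → cur x' = some q → x = x')
    (hN : ∀ x q, cur x = some q → q.1 < N) (y : R) :
    ((edges cur).filter fun p => p.2 = y).card ≤ 4 * N := by
  classical
  let Q : Finset (Slot R) :=
    Finset.range N ×ˢ (Finset.univ : Finset Bool) ×ˢ {y} ×ˢ (Finset.univ : Finset (Fin 2))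
  have hQ : Q.card = 4 * N := by
    simp [Q]
    ring
  rw [← hQ]
  refine Finset.card_le_card_of_forall_subsingleton (fun p q => cur p.1 = some q) ?_ ?_
  · rintro ⟨x, y'⟩ hp
    have hp' := Finset.mem_filter.1 hp
    obtain ⟨q, hq, hy⟩ := mem_edges.1 hp'.1
    refine ⟨q, ?_, hq⟩
    simp only [Q, Finset.mem_product, Finset.mem_range, Finset.mem_univ, Finset.mem_singleton,
      true_and, and_true]
    exact ⟨hN _ _ hq, hy.trans hp'.2⟩
  · rintro q - p ⟨hp, hpq⟩ p' ⟨hp', hpq'⟩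
    refine Prod.ext (hinj _ _ _ hpq hpq') ?_
    rw [(Finset.mem_filter.1 hp).2, (Finset.mem_filter.1 hp').2]

variable [DecidableEq L]

lemma edges_removeEdges (cur : L → Option (Slot R)) (rem : Finset (L × R)) :
    edges (removeEdges cur rem) = edges cur \ rem := by
  ext ⟨x, y⟩
  simp only [mem_edges, Finset.mem_sdiff, removeEdges_eq_some]
  constructor
  · rintro ⟨q, ⟨h1, h2⟩, rfl⟩
    exact ⟨⟨q, h1, rfl⟩, h2⟩
  · rintro ⟨⟨q, h1, rfl⟩, h2⟩
    exact ⟨q, ⟨h1, h2⟩, rfl⟩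

end Slots

/-- The memory of Matcher.  `cur` tells the slots of the matched left nodes, `copy j` the copy
selected by layer `j`, `born x` the round at which `x` got its slot, and `out` is the last reply. -/
structure State (L R : Type) where
  time : ℕ
  cur : L → Option (Slot R)
  copy : ℕ → Bool
  layer : ℕ → Layer L R
  born : L → ℕ
  out : Finset (L × R)

section Strategy

variable {L R : Type}

open Classical in
/-- The slot offered to `x` by the first layer that can serve it. -/
def firstSlot (Nbr : L → Finset R) (layer : ℕ → Layer L R) (copy : ℕ → Bool) (x : L) :
    Option (Slot R) :=
  if h : ∃ j, ((layer j).cell Nbr x).isSome then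
    some (Nat.find h, copy (Nat.find h), ((layer (Nat.find h)).cell Nbr x).get (Nat.find_spec h))
  else none

lemma firstSlot_eq_some {Nbr : L → Finset R} {layer : ℕ → Layer L R} {copy : ℕ → Bool} {x : L}
    {j : ℕ} {b : Bool} {c : R × Fin 2} (h : firstSlot Nbr layer copy x = some (j, b, c)) :
    (∀ i < j, (layer i).cell Nbr x = none) ∧ b = copy j ∧ (layer j).cell Nbr x = some c := by
  classical
  unfold firstSlot at h
  split_ifs at h with hex
  simp only [Option.some.injEq, Prod.mk.injEq] at h
  obtain ⟨rfl, rfl, rfl⟩ := h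
  refine ⟨fun i hi => ?_, rfl, by simp⟩
  simpa using Nat.find_min hex hi

lemma firstSlot_eq_none {Nbr : L → Finset R} {layer : ℕ → Layer L R} {copy : ℕ → Bool} {x : L}
    (h : firstSlot Nbr layer copy x = none) (j : ℕ) : (layer j).cell Nbr x = none := by
  unfold firstSlot at h
  split_ifs at h with hex
  simpa using not_exists.1 hex j

/-- The edge at `x` given by a slot. -/
def edgeOf (x : L) (q : Option (Slot R)) : Finset (L × R) :=
  q.elim ∅ fun q => {(x, q.2.2.1)}

variable [DecidableEq L]

/-- Matcher processes the request `x`: she repeats the edge of `x` if `x` is matched. -/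
def State.serve (Nbr : L → Finset R) (s : State L R) (x : L) : State L R :=
  if (s.cur x).isSome then { s with time := s.time + 1, out := edgeOf x (s.cur x) }
  else
    { time := s.time + 1
      cur := Function.update s.cur x (firstSlot Nbr s.layer s.copy x)
      copy := s.copy
      layer := askLayers Nbr s.layer x
      born := Function.update s.born x s.time
      out := edgeOf x (firstSlot Nbr s.layer s.copy x) }

lemma State.serve_time (Nbr : L → Finset R) (s : State L R) (x : L) :
    (s.serve Nbr x).time = s.time + 1 := by
  unfold State.serve
  split_ifs <;> rfl

/-- The state before the first round. -/
def State.start : State L R := ⟨0, fun _ => none, fun _ => true, fun _ => ⟨∅, fun _ => none, ∅⟩,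
  fun _ => 0, ∅⟩

/-- The invariant of the state in the epochs of round `e`, where `d` tells whether the request
of round `e` has been processed, the removals before round `n` have taken place, and `reply` is
the sequence of replies of Matcher. -/
structure StateOk (Nbr : L → Finset R) (K J : ℕ) (req : ℕ → ReqMove L R)
    (reply : ℕ → Finset (L × R)) (e d n : ℕ) (s : State L R) : Prop where
  layers : LayersOk Nbr K J e d s.layer
  inj : ∀ x x' q, s.cur x = some q → s.cur x' = some q → x = x'
  lt : ∀ x q, s.cur x = some q → q.1 < J + Nat.log 2 K + 1
  adj : ∀ x q, s.cur x = some q → q.2.2.1 ∈ Nbr x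
  current : ∀ x j c, s.cur x = some (j, s.copy j, c) →
    c ∈ (s.layer j).blocked ∨ (s.layer j).served x = some c
  old : ∀ x j b c, s.cur x = some (j, b, c) → b ≠ s.copy j →
    s.born x < e / epochLen K J j * epochLen K J j
  born_lt : ∀ x q, s.cur x = some q → s.born x < n
  reply_born : ∀ x q, s.cur x = some q → reply (s.born x) = {(x, q.2.2.1)}
  alive : ∀ x q, s.cur x = some q → ∀ m, s.born x < m → m < n → (x, q.2.2.1) ∉ (req m).1

lemma StateOk.start (Nbr : L → Finset R) (K J : ℕ) (req : ℕ → ReqMove L R)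
    (reply : ℕ → Finset (L × R)) : StateOk Nbr K J req reply 0 1 0 State.start where
  layers :=
    { ok := fun j => ⟨by simp [State.start], by simp [State.start], by simp [State.start]⟩
      blocked_card := by simp [State.start]
      blocked_late := by simp [State.start]
      carry := by simp [State.start]
      seen_zero := by simp [State.start] }
  inj := by simp [State.start]
  lt := by simp [State.start]
  adj := by simp [State.start]
  current := by simp [State.start]
  old := by simp [State.start]
  born_lt := by simp [State.start]
  reply_born := by simp [State.start]
  alive := by simp [State.start]

lemma askLayers_blocked (Nbr : L → Finset R) (layer : ℕ → Layer L R) (x : L) (j : ℕ) :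
    (askLayers Nbr layer x j).blocked = (layer j).blocked := by
  unfold askLayers
  split_ifs <;> rfl

lemma askLayers_served {Nbr : L → Finset R} {layer : ℕ → Layer L R} {x x' : L} {j : ℕ} {c : R × Fin 2}
    (h : (layer j).served x' = some c) : (askLayers Nbr layer x j).served x' = some c := by
  unfold askLayers
  split_ifs
  · exact Layer.ask_served_of_served h
  · exact h

variable [DecidableEq R]

/-- Some layer can serve the request. -/
lemma LayersOk.exists_firstSlot {Nbr : L → Finset R} {K J : ℕ} {layer : ℕ → Layer L R}
    {e : ℕ}
    (h : LayersOk Nbr K J e 0 layer) (hG : Expansion Nbr 1 K) (hK : 0 < K) (copy : ℕ → Bool)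
    (x : L) : ∃ q, firstSlot Nbr layer copy x = some q := by
  rw [← Option.ne_none_iff_exists']
  intro hnone
  have := (h.ask x).lt_of_mem_seen hG hK le_rfl (j := J + Nat.log 2 K + 1) (x := x) (by
    rw [askLayers, if_pos fun i _ => firstSlot_eq_none hnone i]
    simp [Layer.ask])
  omega

variable [Fintype L] [Fintype R]

open Classical in
/-- Requester removes the edges in `rem`, and new epochs begin. -/
def State.begin (K J : ℕ) (s : State L R) (rem : Finset (L × R)) : State L R :=
  { s with
    cur := removeEdges s.cur rem
    copy := fun j =>
      if epochLen K J j ∣ s.time then lighter (removeEdges s.cur rem) j else s.copy j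
    layer := resetLayers K J s.time
      (fun j => occupied (removeEdges s.cur rem) j (lighter (removeEdges s.cur rem) j)) s.layer }

/-- A full round. -/
def State.step (Nbr : L → Finset R) (K J : ℕ) (s : State L R) (r : ReqMove L R) : State L R :=
  (s.begin K J r.1).serve Nbr r.2

/-- The state before round `n` of a play. -/
def stateAt (Nbr : L → Finset R) (K J : ℕ) (req : ℕ → ReqMove L R) : ℕ → State L R
  | 0 => State.start
  | n + 1 => (stateAt Nbr K J req n).step Nbr K J (req n)

/-- The strategy of Matcher. -/
def layeredStrategy (Nbr : L → Finset R) (K J : ℕ) : Strategy L R :=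
  fun h => (h.foldl (State.step Nbr K J) State.start).out

lemma layeredStrategy_histUpTo (Nbr : L → Finset R) (K J : ℕ) (req : ℕ → ReqMove L R) (n : ℕ) :
    layeredStrategy Nbr K J (histUpTo req n) = (stateAt Nbr K J req (n + 1)).out := by
  have key : ∀ n, (List.ofFn fun i : Fin n => req i.1).foldl (State.step Nbr K J) State.start =
      stateAt Nbr K J req n := by
    intro n
    induction n with
    | zero => simp [stateAt]
    | succ n ih =>
      rw [List.ofFn_succ_last, List.foldl_append]
      simp only [Fin.val_castSucc, Fin.val_last, List.foldl_cons, List.foldl_nil]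
      rw [ih, stateAt]
  rw [layeredStrategy, histUpTo, key]

lemma stateAt_time (Nbr : L → Finset R) (K J : ℕ) (req : ℕ → ReqMove L R) (n : ℕ) :
    (stateAt Nbr K J req n).time = n := by
  induction n with
  | zero => rfl
  | succ n ih =>
    rw [stateAt, State.step, State.serve_time]
    exact congrArg (· + 1) ih

variable {Nbr : L → Finset R} {K J T : ℕ} {req : ℕ → ReqMove L R}
  {reply : ℕ → Finset (L × R)} {n : ℕ} {s : State L R}

/-- When an epoch of a late layer begins, all edges in the copy that the layer did not use
during the last epoch have expired. -/
lemma StateOk.occupied_eq_empty (h : StateOk Nbr K J req reply (n - 1) 1 n s) (hK : 0 < K)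
    (hJ : T ≤ K * 2 ^ J)
    (hexp : ∀ i, i + T ≤ n → ∃ j, i < j ∧ j ≤ i + T ∧ ∀ e ∈ reply i, e ∈ (req j).1)
    {j : ℕ} (hj : J ≤ j) (hd : epochLen K J j ∣ n) :
    occupied (removeEdges s.cur (req n).1) j (!(s.copy j)) = ∅ := by
  rw [Finset.eq_empty_iff_forall_notMem]
  intro c hc
  obtain ⟨x, hx⟩ := mem_occupied.1 hc
  obtain ⟨hx, hrem⟩ := removeEdges_eq_some.1 hx
  have hold := h.old _ _ _ _ hx (by simp)
  have hlt := h.born_lt _ _ hx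
  have hlen : T ≤ epochLen K J j := by rwa [epochLen, min_eq_right hj]
  have hborn : s.born x + T ≤ n := by
    obtain ⟨q, rfl⟩ := hd
    have hpos := epochLen_pos (J := J) hK j
    set l := epochLen K J j
    rcases q with _ | q
    · omega
    · have hq : (l * (q + 1) - 1) / l = q := by
        rw [Nat.div_eq_iff hpos, mul_add, mul_comm q l]
        omega
      rw [hq] at hold
      rw [mul_add, mul_comm l q]
      omega
  obtain ⟨m, hm1, hm2, hm3⟩ := hexp _ hborn
  have hmem := hm3 (x, c.1) (by rw [h.reply_born _ _ hx]; simp)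
  rcases Nat.lt_or_ge m n with hmn | hmn
  · exact h.alive _ _ hx m hm1 hmn hmem
  · obtain rfl : m = n := by omega
    exact hrem hmem

lemma StateOk.begin (h : StateOk Nbr K J req reply (n - 1) 1 n s) (hG : Expansion Nbr 1 K)
    (hK : 0 < K) (hJ : T ≤ K * 2 ^ J) (ht : s.time = n)
    (hcard : (edges (removeEdges s.cur (req n).1)).card < K)
    (hexp : ∀ i, i + T ≤ n → ∃ j, i < j ∧ j ≤ i + T ∧ ∀ e ∈ reply i, e ∈ (req j).1) :
    StateOk Nbr K J req reply n 0 (n + 1) (s.begin K J (req n).1) where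
  layers := by
    simp only [State.begin, ht]
    refine h.layers.reset hG hK (fun j => ?_) fun j hj hd => ?_
    · exact (two_mul_card_occupied_lighter _ j).trans hcard.le
    · have h1 := card_occupied_lighter (removeEdges s.cur (req n).1) j !(s.copy j)
      rw [h.occupied_eq_empty hK hJ hexp hj hd, Finset.card_empty, Nat.le_zero,
        Finset.card_eq_zero] at h1
      exact h1
  inj x x' q hx hx' := h.inj x x' q (removeEdges_eq_some.1 hx).1 (removeEdges_eq_some.1 hx').1
  lt x q hx := h.lt x q (removeEdges_eq_some.1 hx).1
  adj x q hx := h.adj x q (removeEdges_eq_some.1 hx).1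
  current x j c hx := by
    simp only [State.begin, ht, resetLayers] at hx ⊢
    split_ifs with hd
    · rw [if_pos hd] at hx
      exact Or.inl (mem_occupied.2 ⟨x, hx⟩)
    · rw [if_neg hd] at hx
      exact h.current x j c (removeEdges_eq_some.1 hx).1
  old x j b c hx hb := by
    simp only [State.begin, ht] at hx hb ⊢
    have hx' := (removeEdges_eq_some.1 hx).1
    split_ifs at hb with hd
    · rw [Nat.div_mul_cancel hd]
      exact h.born_lt _ _ hx'
    · have hn : n ≠ 0 := by rintro rfl; exact hd (dvd_zero _)
      obtain ⟨m, rfl⟩ := Nat.exists_eq_succ_of_ne_zero hn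
      have hold := h.old _ _ _ _ hx' hb
      simp only [Nat.succ_eq_add_one, Nat.add_sub_cancel] at hold hd ⊢
      rwa [Nat.succ_div, if_neg hd, add_zero]
  born_lt x q hx := (h.born_lt x q (removeEdges_eq_some.1 hx).1).trans (Nat.lt_succ_self n)
  reply_born x q hx := h.reply_born x q (removeEdges_eq_some.1 hx).1
  alive x q hx m hm hmn := by
    obtain ⟨hx, hrem⟩ := removeEdges_eq_some.1 hx
    rcases Nat.lt_or_ge m n with hlt | hge
    · exact h.alive x q hx m hm hlt
    · obtain rfl : m = n := by omega
      exact hrem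

lemma StateOk.serve (h : StateOk Nbr K J req reply n 0 (n + 1) s) (hG : Expansion Nbr 1 K)
    (hK : 0 < K) (ht : s.time = n) (x : L) (hr : reply n = (s.serve Nbr x).out) :
    StateOk Nbr K J req reply n 1 (n + 1) (s.serve Nbr x) ∧
      ∃ y ∈ Nbr x, reply n = {(x, y)} ∧ edges (s.serve Nbr x).cur = {(x, y)} ∪ edges s.cur := by
  cases hx : s.cur x with
  | some q =>
    have hserve : s.serve Nbr x = { s with time := s.time + 1, out := edgeOf x (some q) } := by
      rw [State.serve, hx]; rfl
    rw [hserve] at hr ⊢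
    refine ⟨⟨⟨h.layers.ok, h.layers.blocked_card, h.layers.blocked_late, h.layers.carry,
      h.layers.seen_zero.trans (Nat.le_succ _)⟩, h.inj, h.lt, h.adj, h.current, h.old, h.born_lt,
      h.reply_born, h.alive⟩, q.2.2.1, h.adj _ _ hx, hr, ?_⟩
    refine (Finset.union_eq_right.2 ?_).symm
    rw [Finset.singleton_subset_iff]
    exact mem_edges.2 ⟨q, hx, rfl⟩
  | none =>
    obtain ⟨⟨j, b, c⟩, hq⟩ := h.layers.exists_firstSlot hG hK s.copy x
    have hserve : s.serve Nbr x =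
        { time := s.time + 1
          cur := Function.update s.cur x (some (j, b, c))
          copy := s.copy
          layer := askLayers Nbr s.layer x
          born := Function.update s.born x s.time
          out := {(x, c.1)} } := by
      rw [State.serve, hx, hq]; rfl
    rw [hserve] at hr ⊢
    obtain ⟨hp, rfl, hc⟩ := firstSlot_eq_some hq
    have hask : askLayers Nbr s.layer x j = (s.layer j).ask Nbr x := if_pos hp
    have hserved : (askLayers Nbr s.layer x j).served x = some c := by
      simp [hask, Layer.ask, hc]
    have hly := h.layers.ask x
    have hadj := (hly.ok j).adj _ _ hserved
    have hnew : ∀ x', x' ≠ x → s.cur x' ≠ some (j, s.copy j, c) := by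
      intro x' hne hx'
      rcases h.current _ _ _ hx' with h1 | h1
      · exact hadj.2.1 (by rwa [askLayers_blocked])
      · exact hne ((hly.ok j).inj _ _ _ (askLayers_served h1) hserved)
    refine ⟨⟨hly, ?_, ?_, ?_, ?_, ?_, ?_, ?_, ?_⟩, c.1, hadj.1, hr, ?_⟩
    · intro x₁ x₂ q h₁ h₂
      simp only [Function.update_apply] at h₁ h₂
      split_ifs at h₁ h₂ with e₁ e₂ e₂
      · rw [e₁, e₂]
      · rw [← Option.some.inj h₁] at h₂
        exact absurd h₂ (hnew _ e₂)
      · rw [← Option.some.inj h₂] at h₁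
        exact absurd h₁ (hnew _ e₁)
      · exact h.inj _ _ _ h₁ h₂
    · intro x' q hx'
      simp only [Function.update_apply] at hx'
      split_ifs at hx' with e
      · rw [← Option.some.inj hx']
        exact hly.lt_of_mem_seen hG hK le_rfl hadj.2.2
      · exact h.lt _ _ hx'
    · intro x' q hx'
      simp only [Function.update_apply] at hx'
      split_ifs at hx' with e
      · rw [← Option.some.inj hx', e]
        exact hadj.1
      · exact h.adj _ _ hx'
    · intro x' j' c' hx'
      simp only [Function.update_apply] at hx' ⊢
      split_ifs at hx' with e
      · simp only [Option.some.injEq, Prod.mk.injEq] at hx'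
        obtain ⟨rfl, -, rfl⟩ := hx'
        rw [e]
        exact Or.inr hserved
      · rw [askLayers_blocked]
        exact (h.current _ _ _ hx').imp_right askLayers_served
    · intro x' j' b' c' hx' hb
      simp only [Function.update_apply] at hx' ⊢
      split_ifs at hx' ⊢ with e
      · simp only [Option.some.injEq, Prod.mk.injEq] at hx'
        obtain ⟨rfl, rfl, -⟩ := hx'
        exact absurd rfl hb
      · exact h.old _ _ _ _ hx' hb
    · intro x' q hx'
      simp only [Function.update_apply] at hx' ⊢
      split_ifs at hx' ⊢ with e
      · omega
      · exact h.born_lt _ _ hx'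
    · intro x' q hx'
      simp only [Function.update_apply] at hx' ⊢
      split_ifs at hx' ⊢ with e
      · rw [← Option.some.inj hx', e, ht]
        exact hr
      · exact h.reply_born _ _ hx'
    · intro x' q hx' m hm hmn
      simp only [Function.update_apply] at hx' hm
      split_ifs at hx' hm with e
      · omega
      · exact h.alive _ _ hx' m hm hmn
    · ext ⟨x', y⟩
      simp only [mem_edges, Finset.mem_union, Finset.mem_singleton, Function.update_apply,
        Prod.mk.injEq]
      by_cases e : x' = x
      · subst e
        simp [hx, eq_comm]
      · simp [e]

/-- The strategy keeps the invariant, and replies validly, as long as Requester plays legally. -/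
lemma stateAt_ok (hG : Expansion Nbr 1 K) (hJ : T ≤ K * 2 ^ J) (n : ℕ)
    (hlegal : ∀ i ≤ n, RemLegal (layeredStrategy Nbr K J) K req i)
    (hexp : ∀ i, i + T ≤ n → ExpiredAt (layeredStrategy Nbr K J) T req i) :
    StateOk Nbr K J req (fun m => layeredStrategy Nbr K J (histUpTo req m)) n 1 (n + 1)
        (stateAt Nbr K J req (n + 1)) ∧
      matchingAfter (layeredStrategy Nbr K J) req (n + 1) =
        edges (stateAt Nbr K J req (n + 1)).cur ∧
      ∃ y ∈ Nbr (req n).2, layeredStrategy Nbr K J (histUpTo req n) = {((req n).2, y)} := by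
  have hK : 0 < K := Nat.zero_lt_of_lt (hlegal 0 (Nat.zero_le n))
  have round : ∀ m ≤ n,
      StateOk Nbr K J req (fun m => layeredStrategy Nbr K J (histUpTo req m)) (m - 1) 1 m
        (stateAt Nbr K J req m) →
      matchingAfter (layeredStrategy Nbr K J) req m = edges (stateAt Nbr K J req m).cur →
      StateOk Nbr K J req (fun m => layeredStrategy Nbr K J (histUpTo req m)) m 1 (m + 1)
        (stateAt Nbr K J req (m + 1)) ∧
      matchingAfter (layeredStrategy Nbr K J) req (m + 1) =
        edges (stateAt Nbr K J req (m + 1)).cur ∧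
      ∃ y ∈ Nbr (req m).2, layeredStrategy Nbr K J (histUpTo req m) = {((req m).2, y)} := by
    intro m hm hok hM
    have hcard := hlegal m hm
    rw [RemLegal, hM, ← edges_removeEdges] at hcard
    have hbegin := hok.begin hG hK hJ (stateAt_time ..) hcard fun i hi => hexp i (hi.trans hm)
    obtain ⟨h1, y, hy, hy', hE⟩ := hbegin.serve hG hK (stateAt_time ..) (req m).2
      (layeredStrategy_histUpTo Nbr K J req m)
    refine ⟨h1, ?_, y, hy, hy'⟩
    rw [matchingAfter, hM, hy', ← edges_removeEdges]
    exact hE.symm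
  have all : ∀ m ≤ n,
      StateOk Nbr K J req (fun m => layeredStrategy Nbr K J (histUpTo req m)) (m - 1) 1 m
        (stateAt Nbr K J req m) ∧
      matchingAfter (layeredStrategy Nbr K J) req m = edges (stateAt Nbr K J req m).cur := by
    intro m
    induction m with
    | zero =>
      refine fun _ => ⟨StateOk.start .., ?_⟩
      ext p
      simp [matchingAfter, mem_edges, stateAt, State.start]
    | succ m ih =>
      intro hm
      obtain ⟨h1, h2⟩ := ih (by omega)
      obtain ⟨h3, h4, -⟩ := round m (by omega) h1 h2
      exact ⟨h3, h4⟩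
  exact round n le_rfl (all n le_rfl).1 (all n le_rfl).2

lemma layeredStrategy_validReply (hG : Expansion Nbr 1 K) (hJ : T ≤ K * 2 ^ J) (n : ℕ)
    (hlegal : ∀ i ≤ n, RemLegal (layeredStrategy Nbr K J) K req i)
    (hexp : ∀ i, i + T ≤ n → ExpiredAt (layeredStrategy Nbr K J) T req i) :
    ValidReply Nbr (4 * (J + Nat.log 2 K + 1)) (layeredStrategy Nbr K J) req n := by
  obtain ⟨h, hM, hy⟩ := stateAt_ok hG hJ n hlegal hexp
  refine ⟨hy, fun y => ?_⟩
  rw [hM]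
  exact card_edges_filter_le h.inj h.lt y

end Strategy

end

end DM

open DM
/-- There is an absolute constant `c` such that: if a bipartite graph has
1-expansion up to `K`, then it has matching up to `K` with `T`-expiration and load at
most `c · (log₂ (K·T) + 1)`. -/
theorem stmt7 :
    ∃ c : ℕ, ∀ (L R : Type) [Fintype L] [Fintype R] [DecidableEq L] [DecidableEq R]
      (Nbr : L → Finset R) (K T : ℕ),
      Expansion Nbr 1 K →
      ExpiringMatching Nbr T K (c * (Nat.log 2 (K * T) + 1)) := by
  refine ⟨8, fun L R _ _ _ _ Nbr K T hG => ⟨layeredStrategy Nbr K (Nat.log 2 T + 1), ?_⟩⟩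
  intro req n hlegal hexp
  have hK : 0 < K := Nat.zero_lt_of_lt (hlegal 0 (Nat.zero_le n))
  have hT : 0 < T := by
    rcases Nat.eq_zero_or_pos T with rfl | hT
    · obtain ⟨j, hj, hj', -⟩ := hexp 0 (Nat.zero_le n)
      omega
    · exact hT
  have hJ : T ≤ K * 2 ^ (Nat.log 2 T + 1) :=
    (Nat.lt_pow_succ_log_self (by norm_num) T).le.trans (Nat.le_mul_of_pos_left _ hK)
  have hlog : Nat.log 2 K + Nat.log 2 T ≤ Nat.log 2 (K * T) := by
    refine Nat.le_log_of_pow_le (by norm_num) ?_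
    rw [pow_add]
    exact Nat.mul_le_mul (Nat.pow_log_le_self 2 hK.ne') (Nat.pow_log_le_self 2 hT.ne')
  obtain ⟨hy, hload⟩ := layeredStrategy_validReply hG hJ n hlegal hexp
  exact ⟨hy, fun y => (hload y).trans (by omega)⟩
end

section
/- If a bipartite graph G with left degree D has ((1−ε)D)-expansion up to K, then the (1 + ⌈log₂ K⌉)-clone of G has incremental (2ε)-rich matching up to K (with load 1). -/
namespace DM

variable {L R : Type} [DecidableEq L] [DecidableEq R]

/-- In a graph with `(1-ε)D`-expansion, if each node of `F` has fewer than `(1-2ε)D` neighbors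
outside `N(A)`, then `F` makes up at most half of `A ∪ F`. -/
lemma Expansion.card_le_of_few_new {Nbr : L → Finset R} {D K : ℕ} {ε : ℚ}
    (hD : ∀ x, (Nbr x).card = D) (hexp : Expansion Nbr ((1 - ε) * D) K)
    {A F : Finset L} (hAF : Disjoint A F) (hK : A.card + F.card ≤ K)
    (hF : ∀ x ∈ F, ((Nbr x \ NbrSet Nbr A).card : ℚ) < (1 - 2 * ε) * D) :
    F.card ≤ A.card := by
  rcases F.eq_empty_or_nonempty with rfl | hne
  · simp
  have hε : 0 ≤ ε * D := by
    have hpos : 0 < F.card := Finset.card_pos.2 hne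
    obtain ⟨x, -⟩ := hne
    have h := hexp {x} (by rw [Finset.card_singleton]; omega)
    simp only [NbrSet, Finset.singleton_biUnion, hD, Finset.card_singleton] at h
    push_cast at h
    linarith
  have hsub : NbrSet Nbr (A ∪ F) ⊆ NbrSet Nbr A ∪ F.biUnion fun x => Nbr x \ NbrSet Nbr A := by
    intro y hy
    simp only [NbrSet, Finset.mem_biUnion, Finset.mem_union, Finset.mem_sdiff] at hy ⊢
    grind
  have hupper : ((NbrSet Nbr (A ∪ F)).card : ℚ)
      ≤ A.card * D + ∑ x ∈ F, ((Nbr x \ NbrSet Nbr A).card : ℚ) := by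
    have hA : (NbrSet Nbr A).card ≤ A.card * D :=
      Finset.card_biUnion_le_card_mul _ _ _ fun x _ => (hD x).le
    exact_mod_cast (Finset.card_le_card hsub).trans <| (Finset.card_union_le _ _).trans <|
      add_le_add hA Finset.card_biUnion_le
  have hsum : ∑ x ∈ F, ((Nbr x \ NbrSet Nbr A).card : ℚ) < F.card * ((1 - 2 * ε) * D) := by
    rw [← nsmul_eq_mul, ← Finset.sum_const]
    exact Finset.sum_lt_sum_of_nonempty hne hF
  have hlower := hexp (A ∪ F) (by rwa [Finset.card_union_of_disjoint hAF])
  rw [Finset.card_union_of_disjoint hAF] at hlower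
  push_cast at hlower
  have hlt : 0 < ε * D * ((A.card : ℚ) - F.card) := by linarith
  have := pos_of_mul_pos_right hlt hε
  exact_mod_cast (sub_pos.1 this).le

/-- The level assignment `lev` of the nodes of `S` is greedy with threshold `t`: each node has
fewer than `t` neighbors not yet taken at each level below its own. -/
def GreedyLevels (Nbr : L → Finset R) (t : ℚ) (S : Finset L) (lev : L → ℕ) : Prop :=
  ∀ x ∈ S, ∀ i < lev x, ((Nbr x \ NbrSet Nbr (S.filter fun z => lev z = i)).card : ℚ) < t

lemma card_sdiff_nbrSet_anti {L R : Type} [DecidableEq R] (Nbr : L → Finset R) (x : L)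
    {A B : Finset L} (h : A ⊆ B) :
    (Nbr x \ NbrSet Nbr B).card ≤ (Nbr x \ NbrSet Nbr A).card :=
  Finset.card_le_card <| Finset.sdiff_subset_sdiff subset_rfl <|
    Finset.biUnion_subset_biUnion_of_subset_left _ h

lemma GreedyLevels.insert_update {Nbr : L → Finset R} {t : ℚ} {S : Finset L} {lev : L → ℕ}
    (h : GreedyLevels Nbr t S lev) {x : L} (hx : x ∉ S) {m : ℕ}
    (hm : ∀ i < m, ((Nbr x \ NbrSet Nbr (S.filter fun z => lev z = i)).card : ℚ) < t) :
    GreedyLevels Nbr t (insert x S) (Function.update lev x m) := by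
  intro z hz i hi
  have hsub : (S.filter fun z => lev z = i)
      ⊆ (insert x S).filter fun z => Function.update lev x m z = i := by
    intro w hw
    simp only [Finset.mem_filter, Finset.mem_insert, Function.update_apply] at hw ⊢
    grind
  refine lt_of_le_of_lt (Nat.cast_le.2 (card_sdiff_nbrSet_anti Nbr z hsub)) ?_
  rcases eq_or_ne z x with rfl | hzx
  · exact hm i (by simpa using hi)
  · exact h z (Finset.mem_of_mem_insert_of_ne hz hzx) i (by simpa [hzx] using hi)

/-- The number of nodes at level `m` or above decreases exponentially in `m`. -/
lemma GreedyLevels.two_pow_mul_card_le {Nbr : L → Finset R} {D K : ℕ} {ε : ℚ}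
    (hD : ∀ x, (Nbr x).card = D) (hexp : Expansion Nbr ((1 - ε) * D) K)
    {S : Finset L} {lev : L → ℕ} (h : GreedyLevels Nbr ((1 - 2 * ε) * D) S lev)
    (hK : S.card ≤ K) (m : ℕ) : 2 ^ m * (S.filter fun z => m ≤ lev z).card ≤ S.card := by
  induction m with
  | zero => simp
  | succ m ih =>
    have hdisj : Disjoint (S.filter fun z => lev z = m) (S.filter fun z => m + 1 ≤ lev z) :=
      Finset.disjoint_filter.2 fun z _ h₁ h₂ => by omega
    have hcard : (S.filter fun z => lev z = m).card + (S.filter fun z => m + 1 ≤ lev z).card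
        = (S.filter fun z => m ≤ lev z).card := by
      rw [← Finset.card_union_of_disjoint hdisj, ← Finset.filter_or]
      congr 1
      exact Finset.filter_congr fun z _ => by omega
    have hle := hexp.card_le_of_few_new hD hdisj
      (hcard.trans_le ((Finset.card_filter_le _ _).trans hK)) fun x hx => by
        rw [Finset.mem_filter] at hx
        exact h x hx.1 m hx.2
    calc 2 ^ (m + 1) * (S.filter fun z => m + 1 ≤ lev z).card
        = 2 ^ m * (2 * (S.filter fun z => m + 1 ≤ lev z).card) := by ring
      _ ≤ 2 ^ m * (S.filter fun z => m ≤ lev z).card := Nat.mul_le_mul_left _ (by omega)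
      _ ≤ S.card := ih

/-- A new node has many free neighbors at one of the first `1 + ⌈log₂ K⌉` levels. -/
lemma GreedyLevels.exists_level {Nbr : L → Finset R} {D K : ℕ} {ε : ℚ}
    (hD : ∀ x, (Nbr x).card = D) (hexp : Expansion Nbr ((1 - ε) * D) K)
    {S : Finset L} {lev : L → ℕ} (h : GreedyLevels Nbr ((1 - 2 * ε) * D) S lev)
    (hK : S.card < K) {x : L} (hx : x ∉ S) :
    ∃ i < 1 + Nat.clog 2 K,
      (1 - 2 * ε) * D ≤ ((Nbr x \ NbrSet Nbr (S.filter fun z => lev z = i)).card : ℚ) := by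
  by_contra! hcon
  have hcard : (insert x S).card ≤ K := by rw [Finset.card_insert_of_notMem hx]; omega
  have hpow := (h.insert_update hx hcon).two_pow_mul_card_le hD hexp hcard (1 + Nat.clog 2 K)
  have hpos : 0 < ((insert x S).filter fun z =>
      1 + Nat.clog 2 K ≤ Function.update lev x (1 + Nat.clog 2 K) z).card :=
    Finset.card_pos.2 ⟨x, by simp⟩
  have hclog : K ≤ 2 ^ Nat.clog 2 K := Nat.le_pow_clog one_lt_two K
  have hone : 0 < 2 ^ Nat.clog 2 K := by positivity
  have hmul := Nat.le_mul_of_pos_right (2 ^ (1 + Nat.clog 2 K)) hpos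
  rw [pow_add, pow_one] at hmul hpow
  omega

/-- Matcher wins the incremental rich game if she can maintain an invariant on the matching that
forces its edges to lie in the graph and the load to be bounded. -/
lemma richIncrementalMatching_of_invariant {Nbr : L → Finset R} {D : ℕ} {ε : ℚ} {K ℓ : ℕ}
    (Inv : ℕ → Finset (L × R) → Prop) (hzero : Inv 0 ∅)
    (hstep : ∀ k < K, ∀ M, Inv k M → ∀ x, ∃ M', Inv (k + 1) M' ∧ M ⊆ M' ∧
      (1 - ε) * D ≤ ((M'.filter fun p => p.1 = x).card : ℚ))
    (hedge : ∀ k M, Inv k M → ∀ p ∈ M, p.2 ∈ Nbr p.1)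
    (hload : ∀ k M, Inv k M → ∀ y, (M.filter fun p => p.2 = y).card ≤ ℓ) :
    RichIncrementalMatching Nbr D ε K ℓ := by
  choose! next hnext using hstep
  let play : List (RReqMove L) → ℕ × Finset (L × R) :=
    List.foldl (fun s m => (s.1 + 1, next s.1 s.2 m.2)) (0, ∅)
  let σ : RStrategy L R := fun h => match h.getLast? with
    | none => ∅
    | some m => (play h).2.filter fun p => p.1 = m.2
  refine ⟨σ, fun req _ => ?_⟩
  let state : ℕ → Finset (L × R) := Nat.rec ∅ fun k M => next k M (req k).2
  have hplay : ∀ n, play (List.ofFn fun i : Fin n => req i) = (n, state n) := by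
    intro n
    induction n with
    | zero => rfl
    | succ n ih =>
      rw [List.ofFn_succ_last]
      simp only [play, List.foldl_append, Fin.val_castSucc, Fin.val_last] at ih ⊢
      rw [ih]
      rfl
  have hσ : ∀ n, σ (rhistUpTo req n) = (state (n + 1)).filter fun p => p.1 = (req n).2 := by
    intro n
    have hlast : (rhistUpTo req n).getLast? = some (req n) := by
      rw [rhistUpTo, List.ofFn_succ_last]
      simp
    simp only [σ, hlast]
    rw [rhistUpTo, hplay]
  have hinv : ∀ n ≤ K, Inv n (state n) := by
    intro n
    induction n with
    | zero => exact fun _ => hzero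
    | succ n ih => exact fun hn => (hnext n hn _ (ih (by omega)) _).1
  have hsub : ∀ n ≤ K, rmatchingAfter σ req n ⊆ state n := by
    intro n
    induction n with
    | zero => exact fun _ => subset_rfl
    | succ n ih =>
      intro hn
      rw [rmatchingAfter, hσ]
      exact Finset.union_subset (Finset.filter_subset _ _) <|
        (Finset.filter_subset _ _).trans <| (ih (by omega)).trans
          (hnext n hn _ (hinv n (by omega)) _).2.1
  intro n hn
  refine ⟨fun e he => ?_, ?_, fun y => ?_⟩
  · rw [hσ, Finset.mem_filter] at he
    exact ⟨he.2, hedge _ _ (hinv (n + 1) hn) e he.1⟩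
  · rw [hσ]
    exact (hnext n hn _ (hinv n hn.le) _).2.2
  · exact (Finset.card_le_card (Finset.filter_subset_filter _ (hsub (n + 1) hn))).trans
      (hload _ _ (hinv (n + 1) hn) y)

/-- The matching `M` in the `ℓ`-clone serves each of at most `k` requested nodes `x` with at least
`t` edges into the copy `lev x`, for a greedy assignment of levels, and has load one. -/
def GreedyMatching (Nbr : L → Finset R) (t : ℚ) (ℓ k : ℕ) (M : Finset (L × (R × Fin ℓ))) : Prop :=
  ∃ (S : Finset L) (lev : L → ℕ), S.card ≤ k ∧ GreedyLevels Nbr t S lev ∧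
    (∀ x ∈ S, t ≤ ((M.filter fun p => p.1 = x).card : ℚ)) ∧
    (∀ p ∈ M, p.1 ∈ S ∧ p.2.1 ∈ Nbr p.1 ∧ lev p.1 = p.2.2) ∧
    ∀ p ∈ M, ∀ q ∈ M, p.2 = q.2 → p = q

lemma GreedyMatching.exists_extension {Nbr : L → Finset R} {D K : ℕ} {ε : ℚ}
    (hD : ∀ x, (Nbr x).card = D) (hexp : Expansion Nbr ((1 - ε) * D) K) {k : ℕ} (hk : k < K)
    {M : Finset (L × (R × Fin (1 + Nat.clog 2 K)))}
    (hM : GreedyMatching Nbr ((1 - 2 * ε) * D) (1 + Nat.clog 2 K) k M) (x : L) :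
    ∃ M', GreedyMatching Nbr ((1 - 2 * ε) * D) (1 + Nat.clog 2 K) (k + 1) M' ∧ M ⊆ M' ∧
      (1 - 2 * ε) * D ≤ ((M'.filter fun p => p.1 = x).card : ℚ) := by
  classical
  obtain ⟨S, lev, hcard, hgreedy, hrich, hedge, hinj⟩ := hM
  by_cases hx : x ∈ S
  · exact ⟨M, ⟨S, lev, by omega, hgreedy, hrich, hedge, hinj⟩, subset_rfl, hrich x hx⟩
  have hex := hgreedy.exists_level hD hexp (hcard.trans_lt hk) hx
  obtain ⟨hmlt, hm⟩ := Nat.find_spec hex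
  have hmin : ∀ i < Nat.find hex,
      ((Nbr x \ NbrSet Nbr (S.filter fun z => lev z = i)).card : ℚ) < (1 - 2 * ε) * D := by
    intro i hi
    by_contra! hcon
    exact Nat.find_min hex hi ⟨hi.trans hmlt, hcon⟩
  generalize Nat.find hex = m at hmlt hm hmin
  let new : Finset (L × (R × Fin (1 + Nat.clog 2 K))) :=
    (Nbr x \ NbrSet Nbr (S.filter fun z => lev z = m)).image fun y => (x, (y, ⟨m, hmlt⟩))
  have hnew : ∀ p ∈ new, p.1 = x ∧ p.2.1 ∈ Nbr x ∧ p.2.2 = ⟨m, hmlt⟩ ∧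
      ∀ q ∈ M, p.2 ≠ q.2 := by
    intro p hp
    obtain ⟨y, hy, rfl⟩ := Finset.mem_image.1 hp
    rw [Finset.mem_sdiff] at hy
    refine ⟨rfl, hy.1, rfl, fun q hq hpq => hy.2 (Finset.mem_biUnion.2 ⟨q.1, ?_, ?_⟩)⟩
    · exact Finset.mem_filter.2 ⟨(hedge q hq).1, by rw [(hedge q hq).2.2, ← hpq]⟩
    · have := (hedge q hq).2.1
      rwa [← hpq] at this
  have hrichx : (1 - 2 * ε) * D ≤ (((M ∪ new).filter fun p => p.1 = x).card : ℚ) := by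
    refine hm.trans (Nat.cast_le.2 ?_)
    rw [← Finset.card_image_of_injective (f := fun y => (x, (y, (⟨m, hmlt⟩ : Fin _)))) _
      fun a b hab => by simpa using hab]
    exact Finset.card_le_card fun p hp =>
      Finset.mem_filter.2 ⟨Finset.mem_union_right _ hp, (hnew p hp).1⟩
  refine ⟨M ∪ new, ⟨insert x S, Function.update lev x m, ?_, hgreedy.insert_update hx hmin, ?_, ?_, ?_⟩,
    Finset.subset_union_left, hrichx⟩
  · rw [Finset.card_insert_of_notMem hx]
    omega
  · intro z hz
    rcases Finset.mem_insert.1 hz with rfl | hz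
    · exact hrichx
    · exact (hrich z hz).trans (Nat.cast_le.2 (Finset.card_le_card
        (Finset.filter_subset_filter _ Finset.subset_union_left)))
  · intro p hp
    rcases Finset.mem_union.1 hp with hp | hp
    · obtain ⟨h₁, h₂, h₃⟩ := hedge p hp
      have hpx : p.1 ≠ x := fun h => hx (h ▸ h₁)
      exact ⟨Finset.mem_insert_of_mem h₁, h₂, by rwa [Function.update_of_ne hpx]⟩
    · obtain ⟨h₁, h₂, h₃, -⟩ := hnew p hp
      rw [h₁, h₃]
      exact ⟨Finset.mem_insert_self _ _, h₂, by simp⟩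
  · intro p hp q hq hpq
    rcases Finset.mem_union.1 hp with hp | hp <;> rcases Finset.mem_union.1 hq with hq | hq
    · exact hinj p hp q hq hpq
    · exact absurd hpq.symm ((hnew q hq).2.2.2 p hp)
    · exact absurd hpq ((hnew p hp).2.2.2 q hq)
    · exact Prod.ext ((hnew p hp).1.trans (hnew q hq).1.symm) hpq

end DM

open DM
/-- If a bipartite graph with left degree `D` has `((1-ε)·D)`-expansion up
to `K`, then its `(1 + ⌈log₂ K⌉)`-clone has incremental `(2ε)`-rich matching up to `K`
with load 1 (richness relative to the degree `D` of the original graph). -/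
theorem stmt8 (L R : Type) [Fintype L] [Fintype R] [DecidableEq L] [DecidableEq R]
    (Nbr : L → Finset R) (D K : ℕ) (ε : ℚ)
    (hD : ∀ x : L, (Nbr x).card = D)
    (hexp : Expansion Nbr ((1 - ε) * D) K) :
    RichIncrementalMatching (clone (1 + Nat.clog 2 K) Nbr) D (2 * ε) K 1 := by
  refine richIncrementalMatching_of_invariant
    (GreedyMatching Nbr ((1 - 2 * ε) * D) (1 + Nat.clog 2 K)) ?_ ?_ ?_ ?_
  · exact ⟨∅, 0, by simp, by simp [GreedyLevels], by simp, by simp, by simp⟩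
  · exact fun k hk M hM x => hM.exists_extension hD hexp hk x
  · rintro k M ⟨S, lev, -, -, -, hedge, -⟩ p hp
    exact Finset.mem_product.2 ⟨(hedge p hp).2.1, Finset.mem_univ _⟩
  · rintro k M ⟨S, lev, -, -, -, -, hinj⟩ y
    refine Finset.card_le_one.2 fun p hp q hq => ?_
    rw [Finset.mem_filter] at hp hq
    exact hinj p hp.1 q hq.1 (hp.2.trans hq.2.symm)
end

section
/- Let G be a bipartite graph with left degree D and let S be a set of left nodes. Then the number of private neighbors of S is at least 2·#N(S) − D·#S. -/
open DM
/-- Every neighbor of `S` that is not private is incident on at least two edges from `S`. -/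
theorem DM.two_mul_card_nbrSet_le {L R : Type} [Fintype R] [DecidableEq R]
    (Nbr : L → Finset R) (S : Finset L) :
    2 * (NbrSet Nbr S).card ≤ ∑ x ∈ S, (Nbr x).card + (privNbrs Nbr S).card := by
  have edges : ∑ x ∈ S, (Nbr x).card = ∑ y : R, (S.filter fun x => y ∈ Nbr x).card := by
    simpa [Finset.bipartiteAbove, Finset.bipartiteBelow] using
      Finset.sum_card_bipartiteAbove_eq_sum_card_bipartiteBelow
        (s := S) (t := Finset.univ) fun x y => y ∈ Nbr x
  have nbrs : NbrSet Nbr S =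
      Finset.univ.filter fun y => (S.filter fun x => y ∈ Nbr x).card ≠ 0 := by
    ext y
    simp [NbrSet, Finset.filter_eq_empty_iff]
  rw [edges, nbrs, privNbrs, Finset.card_filter, Finset.card_filter, Finset.mul_sum,
    ← Finset.sum_add_distrib]
  refine Finset.sum_le_sum fun y _ => ?_
  split_ifs <;> omega

/-- In a bipartite graph with left degree `D`, the number of private
neighbors of a left set `S` is at least `2·#N(S) − D·#S`. -/
theorem stmt11 (L R : Type) [Fintype L] [Fintype R] [DecidableEq L] [DecidableEq R]
    (Nbr : L → Finset R) (D : ℕ)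
    (hD : ∀ x : L, (Nbr x).card = D) (S : Finset L) :
    2 * ((NbrSet Nbr S).card : ℤ) - (D : ℤ) * (S.card : ℤ)
      ≤ ((privNbrs Nbr S).card : ℤ) := by
  have h := two_mul_card_nbrSet_le Nbr S
  simp only [hD, Finset.sum_const, smul_eq_mul] at h
  zify at h
  linarith
end

section
/- Let G be a bipartite graph with left degree D that has ((2/3)D + 2)-expansion up to K+1. Let Y be a subset of right nodes with #Y ≤ 2K + 1. If P is a set of left nodes such that every x ∈ P satisfies #(N(x) ∩ Y) ≥ D/3, then #P ≤ K. -/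
open DM
/-- Let `G` have left degree `D` and `((2/3)·D + 2)`-expansion up to
`K + 1`.  If `Y` is a set of right nodes with `#Y ≤ 2K + 1` and every `x ∈ P` satisfies
`#(N(x) ∩ Y) ≥ D/3`, then `#P ≤ K`. -/
theorem stmt12 (L R : Type) [Fintype L] [Fintype R] [DecidableEq L] [DecidableEq R]
    (Nbr : L → Finset R) (D K : ℕ)
    (hD : ∀ x : L, (Nbr x).card = D)
    (hexp : Expansion Nbr ((2 / 3 : ℚ) * D + 2) (K + 1))
    (Y : Finset R) (hY : Y.card ≤ 2 * K + 1)
    (P : Finset L) (hP : ∀ x ∈ P, (D : ℚ) / 3 ≤ (((Nbr x ∩ Y).card : ℚ))) :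
    P.card ≤ K := by
  by_contra! hlt
  obtain ⟨S, hSP, hS⟩ := Finset.exists_subset_card_eq (Nat.succ_le_of_lt hlt)
  have hsub : NbrSet Nbr S ⊆ Y ∪ S.biUnion fun x => Nbr x \ Y := by
    intro y hy
    obtain ⟨x, hx, hxy⟩ := Finset.mem_biUnion.1 hy
    by_cases hyY : y ∈ Y
    · exact Finset.mem_union_left _ hyY
    · exact Finset.mem_union_right _
        (Finset.mem_biUnion.2 ⟨x, hx, Finset.mem_sdiff.2 ⟨hxy, hyY⟩⟩)
  have hcard : (NbrSet Nbr S).card ≤ Y.card + ∑ x ∈ S, (Nbr x \ Y).card :=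
    (Finset.card_le_card hsub).trans <| (Finset.card_union_le _ _).trans <|
      Nat.add_le_add_left Finset.card_biUnion_le _
  have hout : ∀ x ∈ S, ((Nbr x \ Y).card : ℚ) ≤ 2 / 3 * D := by
    intro x hx
    have hsplit : ((Nbr x \ Y).card : ℚ) + (Nbr x ∩ Y).card = D := by
      exact_mod_cast (Finset.card_sdiff_add_card_inter (Nbr x) Y).trans (hD x)
    linarith [hP x (hSP hx)]
  have hsum := Finset.sum_le_card_nsmul S _ _ hout
  have hlow := hexp S hS.le
  have hcardQ : ((NbrSet Nbr S).card : ℚ) ≤ Y.card + ∑ x ∈ S, ((Nbr x \ Y).card : ℚ) := by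
    exact_mod_cast hcard
  have hYQ : (Y.card : ℚ) ≤ 2 * K + 1 := by exact_mod_cast hY
  rw [nsmul_eq_mul] at hsum
  have hSQ : (S.card : ℚ) = K + 1 := by exact_mod_cast hS
  rw [hSQ] at hsum hlow
  linarith
end

section
/- Let G be a bipartite graph with left degree D that has ((1/2)D + 3)-expansion up to K. Let Y be any subset of the right nodes, and let A = {x ∈ L : #(N(x) ∩ Y) ≥ D/2}. Then for every left set S disjoint from A with #S ≤ K, one has #(N(S) ∖ Y) ≥ 3·#S. -/
open DM
/-- Let `G` have left degree `D` and `((1/2)·D + 3)`-expansion up to `K`.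
Let `Y` be any set of right nodes and `A = {x : #(N(x) ∩ Y) ≥ D/2}`.  Then every left
set `S` disjoint from `A` with `#S ≤ K` satisfies `#(N(S) \ Y) ≥ 3·#S`. -/
theorem stmt14 (L R : Type) [Fintype L] [Fintype R] [DecidableEq L] [DecidableEq R]
    (Nbr : L → Finset R) (D K : ℕ)
    (hD : ∀ x : L, (Nbr x).card = D)
    (hexp : Expansion Nbr ((1 / 2 : ℚ) * D + 3) K)
    (Y : Finset R) (S : Finset L)
    (hdisj : Disjoint S (Finset.univ.filter fun x : L =>
      (D : ℚ) / 2 ≤ ((Nbr x ∩ Y).card : ℚ)))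
    (hSK : S.card ≤ K) :
    3 * S.card ≤ ((NbrSet Nbr S) \ Y).card := by
  have hY : ((NbrSet Nbr S ∩ Y).card : ℚ) ≤ (1 / 2 : ℚ) * D * S.card := by
    have hunion : NbrSet Nbr S ∩ Y = S.biUnion fun x => Nbr x ∩ Y := by
      simp only [NbrSet, Finset.biUnion_inter]
    calc ((NbrSet Nbr S ∩ Y).card : ℚ) ≤ ∑ x ∈ S, ((Nbr x ∩ Y).card : ℚ) := by
          rw [hunion]
          exact_mod_cast Finset.card_biUnion_le
      _ ≤ ∑ _x ∈ S, (D : ℚ) / 2 := by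
          refine Finset.sum_le_sum fun x hx => ?_
          by_contra! h
          exact Finset.disjoint_left.mp hdisj hx (by simpa using h.le)
      _ = (1 / 2 : ℚ) * D * S.card := by
          rw [Finset.sum_const, nsmul_eq_mul]
          ring
  have hsplit : (((NbrSet Nbr S \ Y).card : ℚ) + ((NbrSet Nbr S ∩ Y).card : ℚ))
      = (NbrSet Nbr S).card := by
    exact_mod_cast Finset.card_sdiff_add_card_inter _ _
  have hS := hexp S hSK
  have : (3 * S.card : ℚ) ≤ ((NbrSet Nbr S \ Y).card : ℚ) := by linarith
  exact_mod_cast this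
end

section
/- Let G be a bipartite graph with left degree D that has ((1/2)D + 3)-expansion up to K, where K ≥ 1. Let M be a subset of the right nodes with #M ≤ K, and let A be the set of left nodes x with #(N(x) ∖ M) ≤ D/2. Then 3·#A ≤ K. -/
open DM
/-- A set of at most `K` left nodes, each with at most `D / 2` neighbors outside a set of
at most `K` right nodes, has at most `K / 3` elements. -/
theorem three_mul_card_le_of_expansion {L R : Type} [DecidableEq L] [DecidableEq R]
    {Nbr : L → Finset R} {D K : ℕ} (hexp : Expansion Nbr ((1 / 2 : ℚ) * D + 3) K)
    {M : Finset R} (hM : M.card ≤ K) {S : Finset L} (hSK : S.card ≤ K)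
    (hS : ∀ x ∈ S, ((Nbr x \ M).card : ℚ) ≤ (D : ℚ) / 2) : 3 * S.card ≤ K := by
  have hsub : NbrSet Nbr S ⊆ M ∪ S.biUnion fun x => Nbr x \ M := by
    intro y hy
    simp only [NbrSet, Finset.mem_biUnion, Finset.mem_union, Finset.mem_sdiff] at hy ⊢
    grind
  have hcard : (NbrSet Nbr S).card ≤ M.card + ∑ x ∈ S, (Nbr x \ M).card :=
    (Finset.card_le_card hsub).trans <| (Finset.card_union_le _ _).trans <|
      Nat.add_le_add_left Finset.card_biUnion_le _
  have hsum : ∑ x ∈ S, ((Nbr x \ M).card : ℚ) ≤ S.card * ((D : ℚ) / 2) := by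
    simpa using Finset.sum_le_card_nsmul S _ _ hS
  have hcard' : ((NbrSet Nbr S).card : ℚ) ≤ M.card + ∑ x ∈ S, ((Nbr x \ M).card : ℚ) := by
    exact_mod_cast hcard
  have hMK : (M.card : ℚ) ≤ K := by exact_mod_cast hM
  have hthree : (3 : ℚ) * S.card ≤ K := by linarith [hexp S hSK]
  exact_mod_cast hthree

/-- Let `G` have left degree `D` and `((1/2)·D + 3)`-expansion up to `K`,
where `K ≥ 1`.  Let `M` be a set of right nodes with `#M ≤ K` and let
`A = {x : #(N(x) \ M) ≤ D/2}`.  Then `3·#A ≤ K`. -/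
theorem stmt15 (L R : Type) [Fintype L] [Fintype R] [DecidableEq L] [DecidableEq R]
    (Nbr : L → Finset R) (D K : ℕ) (hK : 1 ≤ K)
    (hD : ∀ x : L, (Nbr x).card = D)
    (hexp : Expansion Nbr ((1 / 2 : ℚ) * D + 3) K)
    (M : Finset R) (hM : M.card ≤ K) :
    3 * (Finset.univ.filter fun x : L =>
      (((Nbr x \ M).card : ℚ)) ≤ (D : ℚ) / 2).card ≤ K := by
  set A := Finset.univ.filter fun x : L => ((Nbr x \ M).card : ℚ) ≤ (D : ℚ) / 2
  have hmem : ∀ x ∈ A, ((Nbr x \ M).card : ℚ) ≤ (D : ℚ) / 2 := fun x hx =>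
    (Finset.mem_filter.mp hx).2
  rcases le_total A.card K with hAK | hKA
  · exact three_mul_card_le_of_expansion hexp hM hAK hmem
  · obtain ⟨S, hSA, hSK⟩ := Finset.exists_subset_card_eq hKA
    have hS := three_mul_card_le_of_expansion hexp hM hSK.le fun x hx => hmem x (hSA hx)
    omega
end

section
/- Let G be a bipartite graph and let A and B be critical left sets such that #N(A ∩ B) ≥ #(A ∩ B). Then A ∪ B is also critical. -/
open DM
/-- If `A` and `B` are critical left sets (i.e. `#N(A) ≤ #A` and
`#N(B) ≤ #B`) and `#N(A ∩ B) ≥ #(A ∩ B)`, then `A ∪ B` is also critical. -/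
theorem stmt16 (L R : Type) [Fintype L] [Fintype R] [DecidableEq L] [DecidableEq R]
    (Nbr : L → Finset R) (A B : Finset L)
    (hA : (NbrSet Nbr A).card ≤ A.card)
    (hB : (NbrSet Nbr B).card ≤ B.card)
    (hAB : (A ∩ B).card ≤ (NbrSet Nbr (A ∩ B)).card) :
    (NbrSet Nbr (A ∪ B)).card ≤ (A ∪ B).card := by
  have hunion : NbrSet Nbr (A ∪ B) = NbrSet Nbr A ∪ NbrSet Nbr B :=
    Finset.union_biUnion
  have hinter : NbrSet Nbr (A ∩ B) ⊆ NbrSet Nbr A ∩ NbrSet Nbr B :=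
    Finset.subset_inter
      (Finset.biUnion_subset_biUnion_of_subset_left Nbr Finset.inter_subset_left)
      (Finset.biUnion_subset_biUnion_of_subset_left Nbr Finset.inter_subset_right)
  have hcard := Finset.card_le_card hinter
  have hleft := Finset.card_union_add_card_inter A B
  have hright := Finset.card_union_add_card_inter (NbrSet Nbr A) (NbrSet Nbr B)
  rw [hunion]
  omega
end

section
/- There is an absolute constant c such that for all integers N ≥ 2 and 1 ≤ K ≤ N there exist an integer D with 1 ≤ D ≤ c·log₂ N and a bipartite graph with N left nodes, left degree D, and at most c·K·D right nodes, that has ((3/4)D)-expansion up to K. -/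
open DM

/-- Resampling the value of a function at one point does not change a uniform sum. -/
lemma sum_sum_update {L β : Type*} [Fintype L] [DecidableEq L] [Fintype β] [DecidableEq β]
    (x : L) (F : (L → β) → ℕ) :
    ∑ h : L → β, ∑ v : β, F (Function.update h x v) = Fintype.card β * ∑ h : L → β, F h := by
  have hinv : Function.Involutive
      (fun p : (L → β) × β => (Function.update p.1 x p.2, p.1 x)) := by
    rintro ⟨h, v⟩
    simp
  have key : ∑ p : (L → β) × β, F (Function.update p.1 x p.2) = ∑ p : (L → β) × β, F p.1 :=
    Fintype.sum_bijective _ hinv.bijective _ _ fun _ => rfl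
  rw [Fintype.sum_prod_type, Fintype.sum_prod_type] at key
  rw [key, Finset.mul_sum]
  simp

/-- The exponential moment of the number of collisions of a uniformly random function on a
set `S` is at most `2 ^ #S`, provided the codomain has at least `W * #S` elements. -/
lemma sum_pow_collisions_le {L β : Type*} [Fintype L] [DecidableEq L] [Fintype β]
    [DecidableEq β] (W : ℕ) (hβ : 0 < Fintype.card β) (S : Finset L)
    (hS : W * S.card ≤ Fintype.card β) :
    ∑ h : L → β, W ^ (S.card - (S.image h).card) ≤ 2 ^ S.card * Fintype.card (L → β) := by
  induction S using Finset.induction_on with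
  | empty => simp
  | insert x S hx ih =>
    rw [Finset.card_insert_of_notMem hx] at hS ⊢
    have hS' : W * S.card ≤ Fintype.card β := le_trans (by gcongr; omega) hS
    refine Nat.le_of_mul_le_mul_left ?_ hβ
    rw [← sum_sum_update x]
    have inner (h : L → β) :
        ∑ v : β, W ^ (S.card + 1 - ((insert x S).image (Function.update h x v)).card)
          ≤ 2 * Fintype.card β * W ^ (S.card - (S.image h).card) := by
      have himg (v : β) : (insert x S).image (Function.update h x v) = insert v (S.image h) := by
        rw [Finset.image_insert, Function.update_self]
        congr 1
        refine Finset.image_congr fun y hy => Function.update_of_ne ?_ _ _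
        rintro rfl
        exact hx hy
      have hle : (S.image h).card ≤ S.card := Finset.card_image_le
      have term (v : β) :
          W ^ (S.card + 1 - ((insert x S).image (Function.update h x v)).card)
            ≤ W ^ (S.card - (S.image h).card) +
              if v ∈ S.image h then W * W ^ (S.card - (S.image h).card) else 0 := by
        rw [himg]
        split_ifs with hv
        · rw [Finset.insert_eq_of_mem hv, Nat.sub_add_comm hle, pow_succ, mul_comm]
          exact Nat.le_add_left _ _
        · rw [Finset.card_insert_of_notMem hv, Nat.add_sub_add_right, add_zero]
      calc _ ≤ _ := Finset.sum_le_sum fun v _ => term v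
        _ = (Fintype.card β + W * (S.image h).card) * W ^ (S.card - (S.image h).card) := by
          rw [Finset.sum_add_distrib, ← Finset.sum_filter, Finset.filter_mem_eq_inter,
            Finset.univ_inter, Finset.sum_const, Finset.sum_const, Finset.card_univ,
            smul_eq_mul, smul_eq_mul]
          ring
        _ ≤ _ := by
          gcongr
          have := Nat.mul_le_mul_left W hle
          omega
    calc _ ≤ _ := Finset.sum_le_sum fun h _ => inner h
      _ = 2 * Fintype.card β * ∑ h : L → β, W ^ (S.card - (S.image h).card) := by
        rw [Finset.mul_sum]
      _ ≤ 2 * Fintype.card β * (2 ^ S.card * Fintype.card (L → β)) := by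
        gcongr
        exact ih hS'
      _ = _ := by ring

/-- Among `D`-tuples of functions into a codomain with at least `2 ^ 16 * #S` elements, those
whose images of `S` have total size below `(3 / 4) * D * #S` have density at most
`2 ^ (-3 * D * #S)`. -/
lemma card_small_images_mul_le {L β : Type*} [Fintype L] [DecidableEq L] [Fintype β]
    [DecidableEq β] (D : ℕ) (hβ : 0 < Fintype.card β) (S : Finset L)
    (hS : 2 ^ 16 * S.card ≤ Fintype.card β) :
    (Finset.univ.filter fun f : Fin D → L → β =>
        4 * ∑ i, (S.image (f i)).card < 3 * D * S.card).card * 2 ^ (3 * D * S.card)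
      ≤ Fintype.card (Fin D → L → β) := by
  have moment : ∑ f : Fin D → L → β, ∏ i, (2 ^ 16) ^ (S.card - (S.image (f i)).card)
      ≤ (2 ^ S.card * Fintype.card (L → β)) ^ D := by
    rw [← Fintype.sum_pow (fun h : L → β => (2 ^ 16) ^ (S.card - (S.image h).card)) D]
    gcongr
    exact sum_pow_collisions_le _ hβ S hS
  have markov : (Finset.univ.filter fun f : Fin D → L → β =>
        4 * ∑ i, (S.image (f i)).card < 3 * D * S.card).card * 2 ^ (4 * (D * S.card))
      ≤ ∑ f : Fin D → L → β, ∏ i, (2 ^ 16) ^ (S.card - (S.image (f i)).card) := by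
    rw [← smul_eq_mul, ← Finset.sum_const]
    refine (Finset.sum_le_sum fun f hf => ?_).trans
      (Finset.sum_le_sum_of_subset (Finset.subset_univ _))
    rw [Finset.prod_pow_eq_pow_sum, ← pow_mul]
    refine Nat.pow_le_pow_right two_pos ?_
    have hsum : ∑ i, (S.card - (S.image (f i)).card) + ∑ i, (S.image (f i)).card
        = D * S.card := by
      rw [← Finset.sum_add_distrib,
        Finset.sum_congr rfl fun i _ => Nat.sub_add_cancel Finset.card_image_le]
      simp
    have hf' := (Finset.mem_filter.mp hf).2
    rw [mul_assoc] at hf'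
    omega
  have hpos : 0 < 2 ^ (D * S.card) := by positivity
  refine Nat.le_of_mul_le_mul_right ?_ hpos
  calc _ = (Finset.univ.filter fun f : Fin D → L → β =>
        4 * ∑ i, (S.image (f i)).card < 3 * D * S.card).card * 2 ^ (4 * (D * S.card)) := by
        rw [mul_assoc, ← pow_add]
        congr 2
        ring
    _ ≤ _ := markov.trans moment
    _ = _ := by
      rw [mul_pow, ← pow_mul, Fintype.card_fun (α := Fin D), Fintype.card_fin, mul_comm S.card D,
        mul_comm]

lemma one_add_inv_pow_lt_two {N D : ℕ} (hN : N < 2 ^ D) (hD : 1 ≤ D) :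
    (((2 : ℝ) ^ (3 * D))⁻¹ + 1) ^ N < 2 := by
  have h2 : (2 : ℝ) ≤ 2 ^ D := by simpa using pow_le_pow_right₀ (one_le_two (α := ℝ)) hD
  have hN' : (N : ℝ) ≤ 2 ^ D := by exact_mod_cast hN.le
  have hq : (N : ℝ) * ((2 : ℝ) ^ (3 * D))⁻¹ ≤ 1 / 2 := by
    rw [mul_inv_le_iff₀ (by positivity), mul_comm 3 D, pow_mul]
    nlinarith [mul_le_mul h2 h2 zero_le_two (by positivity)]
  calc _ ≤ (Real.exp (((2 : ℝ) ^ (3 * D))⁻¹)) ^ N := by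
        gcongr
        exact Real.add_one_le_exp _
    _ = Real.exp (N * ((2 : ℝ) ^ (3 * D))⁻¹) := (Real.exp_nat_mul _ _).symm
    _ ≤ Real.exp (1 / 2) := Real.exp_le_exp.mpr hq
    _ < 2 := by
      rw [← Real.lt_log_iff_exp_lt two_pos]
      linarith [Real.log_two_gt_d9]

/-- Some tuple of `D` functions maps every set of at most `K` points to images of total size
at least `(3 / 4) * D * #S`. -/
lemma exists_forall_large_images {N K D : ℕ} (hN : N < 2 ^ D) (hD : 1 ≤ D) (hK : 1 ≤ K) :
    ∃ f : Fin D → Fin N → Fin (2 ^ 16 * K), ∀ S : Finset (Fin N), S.card ≤ K →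
      3 * D * S.card ≤ 4 * ∑ i, (S.image (f i)).card := by
  by_contra! hbad
  let bad (S : Finset (Fin N)) : Finset (Fin D → Fin N → Fin (2 ^ 16 * K)) :=
    Finset.univ.filter fun f => 4 * ∑ i, (S.image (f i)).card < 3 * D * S.card
  let sets : Finset (Finset (Fin N)) := Finset.univ.filter fun S => S.card ≤ K ∧ S ≠ ∅
  have hcard : 0 < Fintype.card (Fin (2 ^ 16 * K)) := by
    rw [Fintype.card_fin]
    positivity
  have hne : Nonempty (Fin (2 ^ 16 * K)) := Fintype.card_pos_iff.mp hcard
  set T : ℕ := Fintype.card (Fin D → Fin N → Fin (2 ^ 16 * K)) with hT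
  have hTpos : (0 : ℝ) < T := by exact_mod_cast Fintype.card_pos
  have cover : T ≤ ∑ S ∈ sets, (bad S).card := by
    refine le_trans ?_ Finset.card_biUnion_le
    rw [hT, ← Finset.card_univ]
    refine Finset.card_le_card fun f _ => ?_
    obtain ⟨S, hSK, hlt⟩ := hbad f
    refine Finset.mem_biUnion.mpr
      ⟨S, Finset.mem_filter.mpr ⟨Finset.mem_univ _, hSK, ?_⟩,
        Finset.mem_filter.mpr ⟨Finset.mem_univ _, hlt⟩⟩
    rintro rfl
    simp at hlt
  set q : ℝ := ((2 : ℝ) ^ (3 * D))⁻¹ with hq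
  have hqpos : 0 < q := by positivity
  have each (S : Finset (Fin N)) (hS : S ∈ sets) : ((bad S).card : ℝ) ≤ T * q ^ S.card := by
    have hSK := (Finset.mem_filter.mp hS).2.1
    have h := card_small_images_mul_le (β := Fin (2 ^ 16 * K)) D hcard S
      (by rw [Fintype.card_fin]; gcongr)
    have h' : ((bad S).card : ℝ) * 2 ^ (3 * D * S.card) ≤ T := by exact_mod_cast h
    rw [hq, inv_pow, ← pow_mul, ← div_eq_mul_inv, le_div_iff₀ (by positivity)]
    exact h'
  have total : ∑ S ∈ sets, q ^ S.card + 1 ≤ (q + 1) ^ N := by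
    have hsum := Finset.sum_pow_mul_eq_add_pow q 1 (Finset.univ : Finset (Fin N))
    simp only [one_pow, mul_one, Finset.card_univ, Fintype.card_fin] at hsum
    have hempty : (∅ : Finset (Fin N)) ∉ sets := by simp [sets]
    have hins : ∑ S ∈ insert ∅ sets, q ^ S.card = 1 + ∑ S ∈ sets, q ^ S.card := by
      simp [Finset.sum_insert hempty]
    rw [← hsum, add_comm, ← hins]
    exact Finset.sum_le_sum_of_subset_of_nonneg
      (fun S _ => Finset.mem_powerset.mpr (Finset.subset_univ _)) fun _ _ _ => by positivity
  have hlt : ∑ S ∈ sets, q ^ S.card < 1 := by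
    linarith [one_add_inv_pow_lt_two hN hD]
  have hle : (T : ℝ) ≤ T * ∑ S ∈ sets, q ^ S.card := by
    rw [Finset.mul_sum]
    refine le_trans ?_ (Finset.sum_le_sum each)
    exact_mod_cast cover
  nlinarith

/-- There is an absolute constant `c` such that for all `N ≥ 2` and
`1 ≤ K ≤ N` there are an integer `D` with `1 ≤ D ≤ c·log₂ N` and a bipartite graph with
`N` left nodes, left degree `D`, at most `c·K·D` right nodes, that has
`((3/4)·D)`-expansion up to `K`. -/
theorem stmt18 :
    ∃ c : ℕ, ∀ N K : ℕ, 2 ≤ N → 1 ≤ K → K ≤ N →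
      ∃ D : ℕ, 1 ≤ D ∧ D ≤ c * Nat.log 2 N ∧
        ∃ (M : ℕ) (Nbr : Fin N → Finset (Fin M)),
          M ≤ c * K * D ∧ (∀ x, (Nbr x).card = D) ∧
          Expansion Nbr ((3 / 4 : ℚ) * D) K := by
  refine ⟨2 ^ 16, fun N K hN hK _ => ⟨Nat.log 2 N + 1, Nat.le_add_left _ _, ?_, ?_⟩⟩
  · have := Nat.log_pos one_lt_two hN
    omega
  obtain ⟨f, hf⟩ := exists_forall_large_images (K := K)
    (Nat.lt_pow_succ_log_self one_lt_two N) (Nat.le_add_left 1 _) hK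
  set D := Nat.log 2 N + 1
  refine ⟨D * (2 ^ 16 * K), fun x => Finset.univ.image fun i => finProdFinEquiv (i, f i x),
    (mul_comm _ _).le, fun x => ?_, fun S hS => ?_⟩
  · rw [Finset.card_image_of_injective, Finset.card_univ, Fintype.card_fin]
    intro i j hij
    exact congrArg Prod.fst (finProdFinEquiv.injective hij)
  · have hcard : ∑ i, (S.image (f i)).card ≤
        (NbrSet (fun x => Finset.univ.image fun i => finProdFinEquiv (i, f i x)) S).card := by
      rw [← Finset.card_sigma]
      refine Finset.card_le_card_of_injOn (fun p => finProdFinEquiv (p.1, p.2)) ?_ ?_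
      · rintro ⟨i, v⟩ hp
        obtain ⟨x, hx, hv⟩ := Finset.mem_image.mp (Finset.mem_sigma.mp hp).2
        refine Finset.mem_biUnion.mpr ⟨x, hx, Finset.mem_image.mpr ⟨i, Finset.mem_univ _, ?_⟩⟩
        exact congrArg (fun w => finProdFinEquiv (i, w)) hv
      · rintro ⟨i, v⟩ _ ⟨j, w⟩ _ h
        obtain ⟨rfl, rfl⟩ := Prod.mk.inj (finProdFinEquiv.injective h)
        rfl
    have h : (3 * D * S.card : ℚ) ≤ 4 * (NbrSet (fun x =>
        Finset.univ.image fun i => finProdFinEquiv (i, f i x)) S).card := by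
      exact_mod_cast (hf S hS).trans (Nat.mul_le_mul_left 4 hcard)
    linarith
end
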